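/- arXiv:1906.06964 — 2 statements merged into one kernel-verified Lean document; each statement's English description precedes it below -/
import Mathlib

section
/- Let N be a lattice-count family and, for (g,n) with 2g−2+n ≥ 1, let W_{g,n}(z₁,…,zₙ) denote the sum of the series ∑_{b∈ℕⁿ} N_{g,n}(b)·∏ᵢ [bᵢ]·zᵢ^{bᵢ−1} on the punctured unit polydisc. Then for every (g,n) with 2g−2+n ≥ 2 and all pairwise distinct z₁,…,zₙ with 0 < |zᵢ| < 1, writing S = {1,…,n} and ∂ᵢ for the complex partial derivative with respect to zᵢ: ∑_{i=1}^n ∂ᵢ( zᵢ·W_{g,n}(z_S) ) = ∑_{1≤i<j≤n} ( ∂ᵢ[ (2/z_j)·(zᵢ³/(1−zᵢ²)²)·W_{g,n−1}(z_{S∖{j}}) ] + ∂_j[ (2/zᵢ)·(z_j³/(1−z_j²)²)·W_{g,n−1}(z_{S∖{i}}) ] + 2·∂ᵢ∂_j[ (z_j/(zᵢ−z_j))·(zᵢ³/(1−zᵢ²)²)·W_{g,n−1}(z_{S∖{j}}) − (zᵢ/(zᵢ−z_j))·(z_j³/(1−z_j²)²)·W_{g,n−1}(z_{S∖{i}}) ]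 ) + ∑_{i=1}^n ∂ᵢ[ (zᵢ⁴/(1−zᵢ²)²)·( W_{g−1,n+1}(zᵢ,zᵢ,z_{S∖{i}}) + ∑_{g₁+g₂=g, I⊔J=S∖{i}} W_{g₁,|I|+1}(zᵢ,z_I)·W_{g₂,|J|+1}(zᵢ,z_J) ) ], where the W_{g−1,n+1} term is omitted when g = 0 and the inner sum is over ordered pairs (g₁,I),(g₂,J), omitting all terms with (g₁,|I|+1) or (g₂,|J|+1) equal to (0,1) or (0,2). -/
open scoped BigOperators

/-- `[b] = b` for positive `b` and `[0] = 1`. -/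
def br (b : ℕ) : ℕ := if b = 0 then 1 else b

/-- A lattice-count family: symmetric quasi-polynomial functions `N g α : (α → ℕ) → ℚ`
(with `n = card α`), vanishing on odd total parity, with the Do–Norbury base cases and
combinatorial recursion. -/
structure LatticeCountFamily : Type 1 where
  N : (g : ℕ) → (α : Type) → [Fintype α] → [DecidableEq α] → (α → ℕ) → ℚ
  symm : ∀ (g : ℕ) (α β : Type) [Fintype α] [DecidableEq α] [Fintype β] [DecidableEq β]
      (e : α ≃ β) (b : β → ℕ), N g α (b ∘ e) = N g β b
  odd_vanish : ∀ (g : ℕ) (α : Type) [Fintype α] [DecidableEq α],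
      3 ≤ 2 * g + Fintype.card α → ∀ b : α → ℕ, Odd (∑ a, b a) → N g α b = 0
  quasipoly : ∀ (g : ℕ) (α : Type) [Fintype α] [DecidableEq α],
      3 ≤ 2 * g + Fintype.card α → ∀ ε : α → ℕ,
        ∃ P : MvPolynomial α ℚ, ∀ b : α → ℕ, (∀ a, b a % 2 = ε a) →
          N g α b = MvPolynomial.eval (fun a => (b a : ℚ) ^ 2) P
  base_zero_three : ∀ b : Fin 3 → ℕ,
      N 0 (Fin 3) b = if Even (b 0 + b 1 + b 2) then 1 else 0
  base_one_one : ∀ b : Fin 1 → ℕ,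
      N 1 (Fin 1) b = if Even (b 0) then ((b 0 : ℚ) ^ 2 + 20) / 48 else 0
  recursion : ∀ (g : ℕ) (α : Type) [Fintype α] [DecidableEq α],
      4 ≤ 2 * g + Fintype.card α → ∀ b : α → ℕ,
      (∑ i, (b i : ℚ)) * N g α b =
        (1 / 2) * (∑ i, ∑ j ∈ Finset.univ.filter (fun j => j ≠ i),
          ∑ p ∈ Finset.range (b i + b j + 1),
            (if Even (b i + b j - p) then
              (br p : ℚ) * ((b i + b j - p : ℕ) : ℚ) *
                N g (Option {a : α // a ≠ i ∧ a ≠ j})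
                  (fun x => Option.elim x p (fun a => b a.1))
             else 0))
        + (1 / 2) * (∑ i, ∑ p ∈ Finset.range (b i + 1), ∑ q ∈ Finset.range (b i - p + 1),
            (if Even (b i - p - q) then
              (br p : ℚ) * (br q : ℚ) * ((b i - p - q : ℕ) : ℚ) *
                ((if g = 0 then 0 else
                    N (g - 1) (Option (Option {a : α // a ≠ i}))
                      (fun x => Option.elim x p
                        (fun y => Option.elim y q (fun a => b a.1))))
                  + ∑ g₁ ∈ Finset.range (g + 1),
                      ∑ I ∈ (Finset.univ : Finset {a : α // a ≠ i}).powerset,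
                        (if 3 ≤ 2 * g₁ + (I.card + 1) ∧ 3 ≤ 2 * (g - g₁) + (Iᶜ.card + 1) then
                          N g₁ (Option {x : {a : α // a ≠ i} // x ∈ I})
                            (fun x => Option.elim x p (fun a => b a.1.1)) *
                          N (g - g₁) (Option {x : {a : α // a ≠ i} // x ∈ Iᶜ})
                            (fun x => Option.elim x q (fun a => b a.1.1))
                         else 0))
             else 0))

/-- The subtuple of `z` indexed by the finite set `I`, in increasing index order. -/
def restr {n : ℕ} (z : Fin n → ℂ) (I : Finset (Fin n)) : Fin I.card → ℂ :=
  fun j => z ((I.orderIsoOfFin rfl j : {x // x ∈ I}) : Fin n)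

open Filter Topology

lemma termwise_deriv {ι : Type*} (a : ι → ℂ) (k : ι → ℕ) (f : ℂ → ℂ) (z : ℂ)
    (hz1 : ‖z‖ < 1)
    (hs : ∀ w : ℂ, 0 < ‖w‖ → ‖w‖ < 1 → Summable (fun i => a i * w ^ k i))
    (hf : ∀ᶠ w in 𝓝 z, HasSum (fun i => a i * w ^ k i) (f w)) :
    HasSum (fun i => a i * ((k i : ℂ) * z ^ (k i - 1))) (deriv f z) := by
  obtain ⟨ρ, h1, h2⟩ := exists_between hz1
  have hρ0 : 0 < ρ := lt_of_le_of_lt (norm_nonneg _) h1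
  have hn : ‖(ρ : ℂ)‖ = ρ := by simp [abs_of_pos hρ0]
  have hsum := (hs (ρ : ℂ) (by rw [hn]; exact hρ0) (by rw [hn]; exact h2)).norm
  have key := Complex.hasSum_deriv_of_summable_norm (U := Metric.ball (0:ℂ) ρ)
    (F := fun i w => a i * w ^ k i) hsum (fun i => by fun_prop) Metric.isOpen_ball
    (fun i w hw => by
      have : ‖w‖ ≤ ρ := by simpa using (mem_ball_zero_iff.1 hw).le
      rw [norm_mul, norm_mul, norm_pow, norm_pow, hn]
      gcongr) (z := z) (by simpa using h1)
  have e : (fun w => ∑' i, a i * w ^ k i) =ᶠ[𝓝 z] f := hf.mono fun w hw => hw.tsum_eq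
  rw [e.deriv_eq] at key
  have e2 : (fun i => a i * ((k i : ℂ) * z ^ (k i - 1))) =
      fun i => deriv ((fun i w => a i * w ^ k i) i) z := by
    funext i
    simp
  rw [e2]
  exact key

lemma hs_congr {ι : Type*} {f g : ι → ℂ} {a b : ℂ} (h : HasSum f a) (h1 : ∀ x, g x = f x)
    (h2 : b = a) : HasSum g b := by
  rw [h2, funext h1]; exact h

lemma hs_mul {ι κ : Type*} {f : ι → ℂ} {g : κ → ℂ} {a b : ℂ} (hf : HasSum f a) (hg : HasSum g b) :
    HasSum (fun x : ι × κ => f x.1 * g x.2) (a * b) :=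
  hf.mul hg (summable_mul_of_summable_norm hf.summable.norm hg.summable.norm)

lemma hasSum_push {β : Type*} (f : ℕ × ℕ × β → ℂ) (s : ℂ) (h : HasSum f s) :
    HasSum (fun x : ℕ × β => ∑ p ∈ Finset.range (x.1 + 1), f (p, x.1 - p, x.2)) s := by
  let φ : ℕ × ℕ × β → ℕ × β := fun x => (x.1 + x.2.1, x.2.2)
  have h1 := (Equiv.sigmaFiberEquiv φ).hasSum_iff.2 h
  refine h1.sigma fun x => ?_
  obtain ⟨m, b⟩ := x
  let e : {p // p ∈ Finset.range (m+1)} ≃ {y // φ y = (m, b)} :=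
    { toFun := fun p => ⟨(p.1, m - p.1, b), by
        have := Finset.mem_range.1 p.2
        simp only [φ, Prod.mk.injEq, and_true]; omega⟩
      invFun := fun y => ⟨y.1.1, by
        have := y.2
        simp only [φ, Prod.ext_iff] at this
        simp only [Finset.mem_range]; omega⟩
      left_inv := fun p => rfl
      right_inv := fun y => by
        obtain ⟨⟨p, q, c⟩, hy⟩ := y
        simp only [φ, Prod.mk.injEq] at hy
        obtain ⟨hy, rfl⟩ := hy
        simp only [Subtype.mk.injEq, Prod.mk.injEq, and_true, true_and]; omega }
  rw [← e.hasSum_iff]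
  have := Finset.hasSum (Finset.range (m+1)) (fun p => f (p, m - p, b))
  exact this

noncomputable def evn (r : ℕ) : ℂ := if Even r then (r : ℂ) else 0

lemma evn_hasSum (w : ℂ) (hw : ‖w‖ < 1) :
    HasSum (fun r => evn r * w ^ r) (2 * w ^ 2 / (1 - w ^ 2) ^ 2) := by
  have h1 : ‖w ^ 2‖ < 1 := by rw [norm_pow]; exact pow_lt_one₀ (norm_nonneg _) hw (by norm_num)
  have h := (hasSum_coe_mul_geometric_of_norm_lt_one h1).mul_left 2
  have inj : Function.Injective (fun n : ℕ => 2 * n) := fun a b hab => by simpa using hab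
  rw [← inj.hasSum_iff]
  · have e1 : ((fun r => evn r * w ^ r) ∘ fun n : ℕ => 2 * n) =
        fun i : ℕ => 2 * ((i : ℂ) * (w ^ 2) ^ i) := by
      funext n
      simp [evn, pow_mul]
      ring
    rw [e1, mul_div_assoc]
    exact h
  · intro x hx
    have : ¬ Even x := fun ⟨y, hy⟩ => hx ⟨y, by simp only; omega⟩
    simp [evn, this]

noncomputable def XX {α : Type} [Fintype α] (t : α → ℂ) (b : α → ℕ) : ℂ :=
  ∏ a, (br (b a) : ℂ) * t a ^ ((b a : ℤ) - 1)

def WSpec (F : LatticeCountFamily) (W : (g n : ℕ) → (Fin n → ℂ) → ℂ) : Prop :=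
  ∀ g n : ℕ, 3 ≤ 2 * g + n → ∀ z : Fin n → ℂ,
      (∀ i, 0 < ‖z i‖ ∧ ‖z i‖ < 1) →
      HasSum
        (fun b : Fin n → ℕ => (F.N g (Fin n) b : ℂ) *
          ∏ i, (br (b i) : ℂ) * z i ^ ((b i : ℤ) - 1))
        (W g n z)

lemma hasSum_gen {F : LatticeCountFamily} {W : (g n : ℕ) → (Fin n → ℂ) → ℂ} (hW : WSpec F W)
    {α : Type} [Fintype α] [DecidableEq α] (g n : ℕ) (h : 3 ≤ 2 * g + n) (e : Fin n ≃ α)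
    (t : α → ℂ) (ht : ∀ i, 0 < ‖t i‖ ∧ ‖t i‖ < 1) :
    HasSum (fun b : α → ℕ => (F.N g α b : ℂ) * XX t b) (W g n (t ∘ e)) := by
  have h0 := hW g n h (t ∘ e) (fun i => ht _)
  rw [← (Equiv.arrowCongr e (Equiv.refl ℕ)).hasSum_iff]
  convert h0 using 1
  funext b
  simp only [Function.comp_apply]
  congr 1
  · have := F.symm g α (Fin n) e.symm b
    rw [← this]; rfl
  · unfold XX
    symm
    apply Fintype.prod_equiv e
    intro x
    simp [Equiv.arrowCongr]

lemma XX_option {α : Type} [Fintype α] (t : α → ℂ) (b : α → ℕ) (w : ℂ) (p : ℕ) (hw : w ≠ 0) :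
    w * XX (fun o : Option α => o.elim w t) (fun o : Option α => o.elim p b)
      = (br p * w ^ p) * XX t b := by
  unfold XX
  rw [Fintype.prod_option]
  simp only [Option.elim]
  rw [zpow_sub₀ hw]
  simp
  field_simp

lemma hasSum_opt {F : LatticeCountFamily} {W : (g n : ℕ) → (Fin n → ℂ) → ℂ} (hW : WSpec F W)
    {α : Type} [Fintype α] [DecidableEq α] (g n : ℕ) (h : 3 ≤ 2 * g + n) (e : Fin n ≃ Option α)
    (t : α → ℂ) (ht : ∀ i, 0 < ‖t i‖ ∧ ‖t i‖ < 1) (w : ℂ) (hw : 0 < ‖w‖) (hw1 : ‖w‖ < 1) :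
    HasSum (fun x : ℕ × (α → ℕ) => (F.N g (Option α) (fun o => o.elim x.1 x.2) : ℂ) *
      ((br x.1 * w ^ x.1) * XX t x.2)) (w * W g n ((fun o : Option α => o.elim w t) ∘ e)) := by
  have h0 := (hasSum_gen hW g n h e (fun o : Option α => o.elim w t)
    (by rintro (_ | i); exacts [⟨hw, hw1⟩, ht i])).mul_left w
  let E : (ℕ × (α → ℕ)) ≃ (Option α → ℕ) :=
    { toFun := fun x o => o.elim x.1 x.2
      invFun := fun b => (b none, fun a => b (some a))
      left_inv := fun x => rfl
      right_inv := fun b => by ext o; cases o <;> rfl }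
  rw [← E.hasSum_iff] at h0
  refine hs_congr h0 (fun x => ?_) rfl
  change _ = w * ((F.N g (Option α) (fun o => o.elim x.1 x.2) : ℂ) *
    XX (fun o : Option α => o.elim w t) (fun o => o.elim x.1 x.2))
  rw [← XX_option _ _ _ _ (norm_pos_iff.1 hw)]
  ring

lemma hasSum_opt2 {F : LatticeCountFamily} {W : (g n : ℕ) → (Fin n → ℂ) → ℂ} (hW : WSpec F W)
    {α : Type} [Fintype α] [DecidableEq α] (g n : ℕ) (h : 3 ≤ 2 * g + n)
    (e : Fin n ≃ Option (Option α))
    (t : α → ℂ) (ht : ∀ i, 0 < ‖t i‖ ∧ ‖t i‖ < 1) (w : ℂ) (hw : 0 < ‖w‖) (hw1 : ‖w‖ < 1) :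
    HasSum (fun x : ℕ × ℕ × (α → ℕ) =>
      (F.N g (Option (Option α)) (fun o => o.elim x.1 (fun y => y.elim x.2.1 x.2.2)) : ℂ) *
      ((br x.1 * w ^ x.1) * (br x.2.1 * w ^ x.2.1) * XX t x.2.2))
      (w ^ 2 * W g n ((fun o : Option (Option α) => o.elim w (fun y => y.elim w t)) ∘ e)) := by
  have h0 := (hasSum_opt hW g n h e (fun o : Option α => o.elim w t)
    (by rintro (_ | i); exacts [⟨hw, hw1⟩, ht i]) w hw hw1).mul_left w
  let E : (ℕ × ℕ × (α → ℕ)) ≃ (ℕ × (Option α → ℕ)) :=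
    { toFun := fun x => (x.1, fun o => o.elim x.2.1 x.2.2)
      invFun := fun b => (b.1, b.2 none, fun a => b.2 (some a))
      left_inv := fun x => rfl
      right_inv := fun b => by
        refine Prod.ext rfl ?_
        funext o; cases o <;> rfl }
  rw [← E.hasSum_iff] at h0
  refine hs_congr h0 (fun x => ?_) (by ring)
  simp only [Function.comp_apply, E, Equiv.coe_fn_mk]
  have := XX_option t x.2.2 w x.2.1 (norm_pos_iff.1 hw)
  linear_combination (- (F.N g (Option (Option α)) (fun o => o.elim x.1 (fun y => y.elim x.2.1 x.2.2)) : ℂ) *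
      (br x.1 * w ^ x.1)) * this

lemma XX_split {α : Type} [Fintype α] [DecidableEq α] (t : α → ℂ) (b : α → ℕ) (I : Finset α) :
    XX t b = XX (fun a : {x // x ∈ I} => t a.1) (fun a : {x // x ∈ I} => b a.1) *
      XX (fun a : {x // x ∈ Iᶜ} => t a.1) (fun a : {x // x ∈ Iᶜ} => b a.1) := by
  unfold XX
  rw [← Finset.prod_mul_prod_compl I]
  congr 1
  · exact (Finset.prod_coe_sort I (fun a => (br (b a) : ℂ) * t a ^ ((b a : ℤ) - 1))).symm
  · exact (Finset.prod_coe_sort Iᶜ (fun a => (br (b a) : ℂ) * t a ^ ((b a : ℤ) - 1))).symm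

lemma hasSum_prod {F : LatticeCountFamily} {W : (g n : ℕ) → (Fin n → ℂ) → ℂ} (hW : WSpec F W)
    {α : Type} [Fintype α] [DecidableEq α] (I : Finset α)
    (g n : ℕ) (h : 3 ≤ 2 * g + n) (g' n' : ℕ) (h' : 3 ≤ 2 * g' + n')
    (e : Fin n ≃ Option {x // x ∈ I}) (e' : Fin n' ≃ Option {x // x ∈ Iᶜ})
    (t : α → ℂ) (ht : ∀ i, 0 < ‖t i‖ ∧ ‖t i‖ < 1) (w : ℂ) (hw : 0 < ‖w‖) (hw1 : ‖w‖ < 1) :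
    HasSum (fun x : ℕ × ℕ × (α → ℕ) =>
      ((F.N g (Option {x // x ∈ I}) (fun o => o.elim x.1 (fun y => x.2.2 y.1)) : ℂ) *
       (F.N g' (Option {x // x ∈ Iᶜ}) (fun o => o.elim x.2.1 (fun y => x.2.2 y.1)) : ℂ)) *
      ((br x.1 * w ^ x.1) * (br x.2.1 * w ^ x.2.1) * XX t x.2.2))
      (w ^ 2 * (W g n ((fun o : Option {x // x ∈ I} => o.elim w (fun y => t y.1)) ∘ e) *
        W g' n' ((fun o : Option {x // x ∈ Iᶜ} => o.elim w (fun y => t y.1)) ∘ e'))) := by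
  have h0 := hs_mul (hasSum_opt hW g n h e (fun y => t y.1) (fun y => ht _) w hw hw1)
    (hasSum_opt hW g' n' h' e' (fun y => t y.1) (fun y => ht _) w hw hw1)
  let E : (ℕ × ℕ × (α → ℕ)) ≃ ((ℕ × ({x // x ∈ I} → ℕ)) × (ℕ × ({x // x ∈ Iᶜ} → ℕ))) :=
    { toFun := fun x => ((x.1, fun y => x.2.2 y.1), (x.2.1, fun y => x.2.2 y.1))
      invFun := fun b => (b.1.1, b.2.1, fun a => if ha : a ∈ I then b.1.2 ⟨a, ha⟩ else
        b.2.2 ⟨a, Finset.mem_compl.2 ha⟩)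
      left_inv := fun x => by
        refine Prod.ext rfl (Prod.ext rfl ?_)
        funext a
        simp
      right_inv := fun b => by
        refine Prod.ext (Prod.ext rfl ?_) (Prod.ext rfl ?_)
        · funext a
          simp
        · funext a
          have := Finset.mem_compl.1 a.2
          simp [this] }
  rw [← E.hasSum_iff] at h0
  refine hs_congr h0 (fun x => ?_) (by ring)
  simp only [Function.comp_apply, E, Equiv.coe_fn_mk]
  rw [XX_split t x.2.2 I]
  ring

/-- triple push-forward -/
lemma hasSum_push3 {β : Type} (M : ℕ → ℕ → β → ℂ) (s : ℂ) (w : ℂ) (hw1 : ‖w‖ < 1)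
    (h : HasSum (fun x : ℕ × ℕ × β => M x.1 x.2.1 x.2.2 * (w ^ x.1 * w ^ x.2.1)) s) :
    HasSum (fun x : ℕ × β => (∑ p ∈ Finset.range (x.1 + 1), ∑ q ∈ Finset.range (x.1 - p + 1),
      evn (x.1 - p - q) * M p q x.2) * w ^ x.1) (2 * w ^ 2 / (1 - w ^ 2) ^ 2 * s) := by
  have h0 := hs_mul (evn_hasSum w hw1) h
  let E : (ℕ × ℕ × (ℕ × β)) ≃ (ℕ × (ℕ × ℕ × β)) :=
    { toFun := fun x => (x.2.1, (x.2.2.1, x.1, x.2.2.2))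
      invFun := fun y => (y.2.2.1, y.1, y.2.1, y.2.2.2)
      left_inv := fun x => rfl
      right_inv := fun x => rfl }
  have h1 := hasSum_push _ _ (E.hasSum_iff.2 h0)
  let E2 : (ℕ × ℕ × β) ≃ (ℕ × (ℕ × β)) :=
    { toFun := fun x => (x.2.1, x.1, x.2.2)
      invFun := fun x => (x.2.1, x.1, x.2.2)
      left_inv := fun x => rfl
      right_inv := fun x => rfl }
  have h2 := hasSum_push _ _ (E2.hasSum_iff.2 h1)
  refine hs_congr h2 (fun x => ?_) rfl
  rw [Finset.sum_mul]
  refine Finset.sum_congr rfl fun p hp => ?_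
  rw [Finset.sum_mul]
  simp only [Function.comp_apply, E, E2, Equiv.coe_fn_mk]
  refine Finset.sum_congr rfl fun q hq => ?_
  have h1 := Finset.mem_range.1 hp
  have h2 := Finset.mem_range.1 hq
  have : w ^ x.1 = w ^ (x.1 - p - q) * (w ^ p * w ^ q) := by
    rw [← pow_add, ← pow_add]; congr 1; omega
  rw [this]; ring

lemma hasSum_push2 {β : Type} (M : ℕ → β → ℂ) (s : ℂ) (w : ℂ) (hw1 : ‖w‖ < 1)
    (h : HasSum (fun x : ℕ × β => M x.1 x.2 * w ^ x.1) s) :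
    HasSum (fun x : ℕ × β => (∑ p ∈ Finset.range (x.1 + 1),
      evn (x.1 - p) * M p x.2) * w ^ x.1) (2 * w ^ 2 / (1 - w ^ 2) ^ 2 * s) := by
  have h0 := hs_mul (evn_hasSum w hw1) h
  let E : (ℕ × ℕ × β) ≃ (ℕ × (ℕ × β)) :=
    { toFun := fun x => (x.2.1, x.1, x.2.2)
      invFun := fun x => (x.2.1, x.1, x.2.2)
      left_inv := fun x => rfl
      right_inv := fun x => rfl }
  have h2 := hasSum_push _ _ (E.hasSum_iff.2 h0)
  refine hs_congr h2 (fun x => ?_) rfl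
  rw [Finset.sum_mul]
  refine Finset.sum_congr rfl fun p hp => ?_
  simp only [Function.comp_apply, E, Equiv.coe_fn_mk]
  have h1 := Finset.mem_range.1 hp
  have : w ^ x.1 = w ^ (x.1 - p) * w ^ p := by
    rw [← pow_add]; congr 1; omega
  rw [this]; ring


noncomputable def HH (k l : ℕ) : ℂ := 1 - (if k = 0 then 1 else 0) - (if l = 0 then 1 else 0)

lemma HH_norm (k l : ℕ) : ‖HH k l‖ ≤ 1 := by
  unfold HH
  split_ifs <;> norm_num

lemma pair_summable {β : Type} (D : ℕ → β → ℂ)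
    (hs : ∀ w : ℂ, 0 < ‖w‖ → ‖w‖ < 1 → Summable (fun x : ℕ × β => D x.1 x.2 * w ^ x.1))
    (w v : ℂ) (hw : 0 < ‖w‖) (hw' : ‖w‖ < 1) (hv' : ‖v‖ < 1) :
    Summable (fun x : ℕ × ℕ × β => HH x.1 x.2.1 * D (x.1 + x.2.1) x.2.2 * w ^ x.1 * v ^ x.2.1) := by
  obtain ⟨ρ, h1, h2⟩ := exists_between (max_lt hw' hv')
  have hwρ := lt_of_le_of_lt (le_max_left _ _) h1
  have hvρ := lt_of_le_of_lt (le_max_right _ _) h1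
  have hρ0 : 0 < ρ := lt_trans hw hwρ
  have hn : ‖(ρ : ℂ)‖ = ρ := by simp [abs_of_pos hρ0]
  have hsum := (hs (ρ : ℂ) (by rw [hn]; exact hρ0) (by rw [hn]; exact h2)).norm
  have hgeo : Summable (fun k : ℕ => (‖w‖ / ρ) ^ k) :=
    summable_geometric_of_lt_one (by positivity) ((div_lt_one hρ0).2 hwρ)
  have hprod := hgeo.mul_of_nonneg hsum (fun k => by positivity) (fun k => by positivity)
  have inj : Function.Injective (fun x : ℕ × ℕ × β => ((x.1, (x.1 + x.2.1, x.2.2)) : ℕ × (ℕ × β))) := by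
    rintro ⟨a, b, c⟩ ⟨a', b', c'⟩ hab
    simp only [Prod.mk.injEq] at hab
    obtain ⟨rfl, h2, rfl⟩ := hab
    simp only [Prod.mk.injEq, true_and, and_true]; omega
  have hc := hprod.comp_injective inj
  refine Summable.of_norm_bounded hc ?_
  rintro ⟨k, l, b⟩
  simp only [Function.comp_apply, norm_mul, norm_pow, hn]
  have e1 : (‖w‖ / ρ) ^ k * (‖D (k + l) b‖ * ρ ^ (k + l)) = ‖D (k+l) b‖ * ‖w‖ ^ k * ρ ^ l := by
    rw [div_pow, pow_add]; field_simp
  rw [e1]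
  calc ‖HH k l‖ * ‖D (k + l) b‖ * ‖w‖ ^ k * ‖v‖ ^ l ≤ 1 * ‖D (k + l) b‖ * ‖w‖ ^ k * ρ ^ l := by
        gcongr
        exact HH_norm k l
    _ = _ := by ring

lemma pair_value {β : Type} (D : ℕ → β → ℂ) (hD : ∀ b, D 0 b = 0) (A B : ℂ → ℂ)
    (hA : ∀ w : ℂ, 0 < ‖w‖ → ‖w‖ < 1 → HasSum (fun x : ℕ × β => D x.1 x.2 * w ^ x.1) (A w))
    (hB : ∀ w : ℂ, 0 < ‖w‖ → ‖w‖ < 1 → HasSum (fun x : ℕ × β => D x.1 x.2 * w ^ x.1) (B w))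
    (w v : ℂ) (hw : 0 < ‖w‖) (hw' : ‖w‖ < 1) (hv : 0 < ‖v‖) (hv' : ‖v‖ < 1) (hne : w ≠ v) :
    HasSum (fun x : ℕ × ℕ × β => HH x.1 x.2.1 * D (x.1 + x.2.1) x.2.2 * w ^ x.1 * v ^ x.2.1)
      ((v * A w - w * B v) / (w - v)) := by
  obtain ⟨S, hsm⟩ := pair_summable D (fun w h h' => (hA w h h').summable) w v hw hw' hv'
  have hp := (hasSum_push _ _ hsm).mul_left (w - v)
  have hq := ((hA w hw hw').mul_left v).sub ((hB v hv hv').mul_left w)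
  have hne' : w - v ≠ 0 := sub_ne_zero.2 hne
  have key : (v * A w - w * B v) = (w - v) * S := by
    refine hq.unique (hs_congr hp ?_ rfl)
    rintro ⟨s, b⟩
    simp only
    rcases Nat.eq_zero_or_pos s with rfl | hs
    · simp [hD]
    have e1 : ∀ p ∈ Finset.range (s+1), HH p (s - p) * D (p + (s - p)) b * w ^ p * v ^ (s - p) =
        D s b * (w ^ p * v ^ (s + 1 - 1 - p) - (if p = 0 then v ^ s else 0) - (if p = s then w ^ s else 0)) := by
      intro p hp
      have hp' : p ≤ s := by have := Finset.mem_range.1 hp; omega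
      have : p + (s - p) = s := by omega
      rw [this]
      unfold HH
      by_cases h0 : p = 0
      · subst h0
        have h3 : ¬ s = 0 := by omega
        have h4 : ¬ 0 = s := by omega
        simp [h3, h4]
      · by_cases h5 : p = s
        · subst h5; simp [h0]
        · have : s - p ≠ 0 := by omega
          simp [h0, h5, this]; ring
    rw [Finset.sum_congr rfl e1, ← Finset.mul_sum, Finset.sum_sub_distrib, Finset.sum_sub_distrib,
      Finset.sum_ite_eq', Finset.sum_ite_eq']
    have g1 := (Commute.all w v).geom_sum₂_mul (s + 1)
    simp only [Finset.mem_range, Nat.succ_pos, lt_add_iff_pos_right, if_true, Nat.lt_succ_self, zero_lt_one]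
    linear_combination (- D s b) * g1
  rw [key, mul_div_cancel_left₀ _ hne']
  exact hsm

/-- abstract pair lemma -/
lemma hasSum_pair {β : Type} (D : ℕ → β → ℂ) (hD : ∀ b, D 0 b = 0) (A B : ℂ → ℂ)
    (hA : ∀ w : ℂ, 0 < ‖w‖ → ‖w‖ < 1 → HasSum (fun x : ℕ × β => D x.1 x.2 * w ^ x.1) (A w))
    (hB : ∀ w : ℂ, 0 < ‖w‖ → ‖w‖ < 1 → HasSum (fun x : ℕ × β => D x.1 x.2 * w ^ x.1) (B w))
    (z1 z2 : ℂ) (hz1 : 0 < ‖z1‖) (hz1' : ‖z1‖ < 1) (hz2 : 0 < ‖z2‖) (hz2' : ‖z2‖ < 1)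
    (hne : z1 ≠ z2) :
    HasSum (fun x : ℕ × ℕ × β => D (x.1 + x.2.1) x.2.2 *
      ((br x.1 * z1 ^ ((x.1 : ℤ) - 1)) * (br x.2.1 * z2 ^ ((x.2.1 : ℤ) - 1))))
      (deriv (fun w => 1 / z2 * A w) z1 + deriv (fun w => 1 / z1 * B w) z2 +
        deriv (fun w => deriv (fun v => (v * A w - w * B v) / (w - v)) z2) z1) := by
  have hHl : ∀ w : ℂ, 0 < ‖w‖ → ‖w‖ < 1 → HasSum (fun x : ℕ × ℕ × β =>
      (HH x.1 x.2.1 * D (x.1 + x.2.1) x.2.2 * w ^ x.1) * ((x.2.1 : ℂ) * z2 ^ (x.2.1 - 1)))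
      (deriv (fun v => ∑' x : ℕ × ℕ × β, HH x.1 x.2.1 * D (x.1 + x.2.1) x.2.2 * w ^ x.1 * v ^ x.2.1) z2) := by
    intro w hw hw'
    have hss : ∀ v : ℂ, ‖v‖ < 1 → Summable (fun x : ℕ × ℕ × β =>
        HH x.1 x.2.1 * D (x.1 + x.2.1) x.2.2 * w ^ x.1 * v ^ x.2.1) := fun v hv =>
      pair_summable D (fun w h h' => (hA w h h').summable) w v hw hw' hv
    refine termwise_deriv _ _ _ _ hz2' (fun v _ h => hss v h) ?_
    have : ∀ᶠ v in 𝓝 z2, ‖v‖ < 1 := continuous_norm.continuousAt.eventually (gt_mem_nhds hz2')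
    exact this.mono fun v hv => (hss v hv).hasSum
  have hev : ∀ z : ℂ, 0 < ‖z‖ → ‖z‖ < 1 → ∀ᶠ w in 𝓝 z, 0 < ‖w‖ ∧ ‖w‖ < 1 := fun z h h' =>
    (continuous_norm.continuousAt.eventually (lt_mem_nhds h)).and
      (continuous_norm.continuousAt.eventually (gt_mem_nhds h'))
  have h3 : HasSum (fun x : ℕ × ℕ × β =>
      (HH x.1 x.2.1 * D (x.1 + x.2.1) x.2.2 * ((x.2.1 : ℂ) * z2 ^ (x.2.1 - 1))) *
        ((x.1 : ℂ) * z1 ^ (x.1 - 1)))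
      (deriv (fun w => deriv (fun v => (v * A w - w * B v) / (w - v)) z2) z1) := by
    refine termwise_deriv _ _ _ _ hz1' (fun w h h' => ?_) ?_
    · exact (hHl w h h').summable.congr fun x => by ring
    · have hne1 : ∀ᶠ w in 𝓝 z1, w ≠ z2 := isOpen_ne.mem_nhds hne
      filter_upwards [hne1, hev z1 hz1 hz1'] with w hw1 hw2
      refine hs_congr (hHl w hw2.1 hw2.2) (fun x => by ring) ?_
      apply Filter.EventuallyEq.deriv_eq
      have hne2 : ∀ᶠ v in 𝓝 z2, v ≠ w := isOpen_ne.mem_nhds hw1.symm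
      filter_upwards [hne2, hev z2 hz2 hz2'] with v hv1 hv2
      exact (pair_value D hD A B hA hB w v hw2.1 hw2.2 hv2.1 hv2.2 hv1.symm).tsum_eq.symm
  have h1' : HasSum (fun x : ℕ × β => (1 / z2 * D x.1 x.2) * ((x.1 : ℂ) * z1 ^ (x.1 - 1)))
      (deriv (fun w => 1 / z2 * A w) z1) := by
    have : ∀ w : ℂ, 0 < ‖w‖ → ‖w‖ < 1 →
        HasSum (fun x : ℕ × β => (1 / z2 * D x.1 x.2) * w ^ x.1) (1 / z2 * A w) := fun w h h' =>
      hs_congr ((hA w h h').mul_left (1 / z2)) (fun x => by ring) rfl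
    exact termwise_deriv _ _ _ _ hz1' (fun w h h' => (this w h h').summable)
      ((hev z1 hz1 hz1').mono fun w hw => this w hw.1 hw.2)
  have h2' : HasSum (fun x : ℕ × β => (1 / z1 * D x.1 x.2) * ((x.1 : ℂ) * z2 ^ (x.1 - 1)))
      (deriv (fun w => 1 / z1 * B w) z2) := by
    have : ∀ w : ℂ, 0 < ‖w‖ → ‖w‖ < 1 →
        HasSum (fun x : ℕ × β => (1 / z1 * D x.1 x.2) * w ^ x.1) (1 / z1 * B w) := fun w h h' =>
      hs_congr ((hB w h h').mul_left (1 / z1)) (fun x => by ring) rfl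
    exact termwise_deriv _ _ _ _ hz2' (fun w h h' => (this w h h').summable)
      ((hev z2 hz2 hz2').mono fun w hw => this w hw.1 hw.2)
  have h1 : HasSum (fun x : ℕ × ℕ × β => if x.2.1 = 0 then
      (1 / z2 * D x.1 x.2.2) * ((x.1 : ℂ) * z1 ^ (x.1 - 1)) else 0)
      (deriv (fun w => 1 / z2 * A w) z1) := by
    have inj : Function.Injective (fun x : ℕ × β => ((x.1, 0, x.2) : ℕ × ℕ × β)) := by
      rintro ⟨a, b⟩ ⟨a', b'⟩ hab
      simpa using hab
    rw [← inj.hasSum_iff]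
    · exact hs_congr h1' (fun x => by simp) rfl
    · rintro ⟨k, l, b⟩ hx
      rw [if_neg]
      intro (hl : l = 0)
      exact hx ⟨(k, b), by simp [hl]⟩
  have h2 : HasSum (fun x : ℕ × ℕ × β => if x.1 = 0 then
      (1 / z1 * D x.2.1 x.2.2) * ((x.2.1 : ℂ) * z2 ^ (x.2.1 - 1)) else 0)
      (deriv (fun w => 1 / z1 * B w) z2) := by
    have inj : Function.Injective (fun x : ℕ × β => ((0, x.1, x.2) : ℕ × ℕ × β)) := by
      rintro ⟨a, b⟩ ⟨a', b'⟩ hab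
      simpa using hab
    rw [← inj.hasSum_iff]
    · exact hs_congr h2' (fun x => by simp) rfl
    · rintro ⟨k, l, b⟩ hx
      rw [if_neg]
      intro (hl : k = 0)
      exact hx ⟨(l, b), by simp [hl]⟩
  refine hs_congr ((h1.add h2).add h3) ?_ rfl
  rintro ⟨k, l, b⟩
  rcases k with _ | k <;> rcases l with _ | l
  · simp [hD]
  · simp [br]; ring
  · simp [br]; ring
  · have a1 : ((k + 1 : ℕ) : ℤ) - 1 = (k : ℤ) := by push_cast; ring
    have a2 : ((l + 1 : ℕ) : ℤ) - 1 = (l : ℤ) := by push_cast; ring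
    simp only [a1, a2, zpow_natCast, br, HH]
    simp
    ring

lemma XX_single {n : ℕ} (z : Fin (n+1) → ℂ) (b : Fin (n+1) → ℕ) (i : Fin (n+1)) :
    XX z b = (br (b i) * z i ^ ((b i : ℤ) - 1)) *
      XX (fun a : {a // a ≠ i} => z a.1) (fun a => b a.1) := by
  unfold XX
  rw [← Finset.mul_prod_erase Finset.univ _ (Finset.mem_univ i)]
  congr 1
  exact Finset.prod_subtype (p := fun a => a ≠ i) _ (fun x => by simp) _

lemma XX_double {n : ℕ} (z : Fin (n+1) → ℂ) (b : Fin (n+1) → ℕ) (i j : Fin (n+1)) (hij : i ≠ j) :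
    XX z b = ((br (b i) * z i ^ ((b i : ℤ) - 1)) * (br (b j) * z j ^ ((b j : ℤ) - 1))) *
      XX (fun a : {a // a ≠ i ∧ a ≠ j} => z a.1) (fun a => b a.1) := by
  unfold XX
  rw [← Finset.mul_prod_erase Finset.univ _ (Finset.mem_univ i),
    ← Finset.mul_prod_erase (Finset.univ.erase i) _ (Finset.mem_erase.2 ⟨hij.symm, Finset.mem_univ j⟩),
    ← mul_assoc]
  congr 1
  exact Finset.prod_subtype (p := fun a => a ≠ i ∧ a ≠ j) _ (fun x => by simp [and_comm]) _

lemma disc_nhds (z : ℂ) (h : 0 < ‖z‖) (h' : ‖z‖ < 1) : ∀ᶠ w in 𝓝 z, 0 < ‖w‖ ∧ ‖w‖ < 1 :=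
  (continuous_norm.continuousAt.eventually (lt_mem_nhds h)).and
      (continuous_norm.continuousAt.eventually (gt_mem_nhds h'))

lemma lhs_hasSum {F : LatticeCountFamily} {W : (g n : ℕ) → (Fin n → ℂ) → ℂ} (hW : WSpec F W)
    (g n : ℕ) (h : 4 ≤ 2 * g + (n + 1)) (z : Fin (n + 1) → ℂ)
    (hz : ∀ i, 0 < ‖z i‖ ∧ ‖z i‖ < 1) (i : Fin (n+1)) :
    HasSum (fun b : Fin (n+1) → ℕ => (b i : ℂ) * (F.N g (Fin (n+1)) b : ℂ) * XX z b)
      (deriv (fun w => w * W g (n + 1) (Function.update z i w)) (z i)) := by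
  have key : ∀ w : ℂ, 0 < ‖w‖ → ‖w‖ < 1 → HasSum (fun b : Fin (n+1) → ℕ =>
      ((F.N g (Fin (n+1)) b : ℂ) * (br (b i) *
      XX (fun a : {a // a ≠ i} => z a.1) (fun a => b a.1))) * w ^ (b i))
      (w * W g (n + 1) (Function.update z i w)) := by
    intro w hw hw'
    have hw0 : w ≠ 0 := norm_pos_iff.1 hw
    have h0 := (hW g (n+1) (by omega) (Function.update z i w) (fun k => by
      by_cases hk : k = i
      · subst hk; simpa using ⟨norm_pos_iff.1 hw, hw'⟩
      · simpa [hk] using hz k)).mul_left w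
    refine hs_congr h0 (fun b => ?_) rfl
    have e1 := XX_single (Function.update z i w) b i
    have e2 : (fun a : {a // a ≠ i} => Function.update z i w a.1) = fun a => z a.1 := by
      funext a; simp [a.2]
    rw [e2] at e1
    change _ = w * ((F.N g (Fin (n+1)) b : ℂ) * XX (Function.update z i w) b)
    rw [e1, Function.update_self, zpow_sub₀ hw0]
    simp
    field_simp
  have := termwise_deriv _ _ _ (z i) (hz i).2 (fun w h h' => (key w h h').summable)
    ((disc_nhds _ (hz i).1 (hz i).2).mono fun w hw => key w hw.1 hw.2)
  refine hs_congr this (fun b => ?_) rfl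
  rw [XX_single z b i]
  rcases hb : b i with _ | k
  · simp
  · have a1 : ((k + 1 : ℕ) : ℤ) - 1 = (k : ℤ) := by push_cast; ring
    simp only [a1, zpow_natCast]
    simp
    ring

noncomputable def TT (F : LatticeCountFamily) (g : ℕ) {n : ℕ} (b : Fin (n+1) → ℕ) (i j : Fin (n+1)) : ℂ :=
  ∑ p ∈ Finset.range (b i + b j + 1), evn (b i + b j - p) *
    ((br p : ℂ) * (F.N g (Option {a : Fin (n+1) // a ≠ i ∧ a ≠ j})
                  (fun x => Option.elim x p (fun a => b a.1)) : ℂ))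

lemma exists_eqv {n : ℕ} (i j : Fin (n+1)) (hij : i ≠ j) (z : Fin (n+1) → ℂ) :
    ∃ e : Fin n ≃ Option {a : Fin (n+1) // a ≠ i ∧ a ≠ j}, ∀ w : ℂ,
      Function.update z i w ∘ Fin.succAbove j =
        (fun o : Option {a : Fin (n+1) // a ≠ i ∧ a ≠ j} => o.elim w (fun a => z a.1)) ∘ e := by
  classical
  let f : Fin n → Option {a : Fin (n+1) // a ≠ i ∧ a ≠ j} := fun k =>
    if hk : j.succAbove k = i then none else some ⟨j.succAbove k, hk, Fin.succAbove_ne _ _⟩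
  have hf : Function.Bijective f := by
    constructor
    · intro a b hab
      simp only [f] at hab
      apply Fin.succAbove_right_injective (p := j)
      split_ifs at hab with h1 h2 h2
      · rw [h1, h2]
      · simpa using hab
    · rintro (_ | ⟨a, ha⟩)
      · obtain ⟨k, hk⟩ := Fin.exists_succAbove_eq hij
        exact ⟨k, by simp [f, hk]⟩
      · obtain ⟨k, hk⟩ := Fin.exists_succAbove_eq ha.2
        exact ⟨k, by simp [f, hk, ha.1]⟩
  refine ⟨Equiv.ofBijective f hf, fun w => ?_⟩
  funext k
  simp only [Function.comp_apply, Equiv.ofBijective_apply, f]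
  by_cases hk : j.succAbove k = i
  · simp [hk]
  · simp [hk]

lemma exists_eqv' {n : ℕ} (i j : Fin (n+1)) (hij : i ≠ j) (z : Fin (n+1) → ℂ) :
    ∃ e : Fin n ≃ Option {a : Fin (n+1) // a ≠ i ∧ a ≠ j}, ∀ w : ℂ,
      Function.update z j w ∘ Fin.succAbove i =
        (fun o : Option {a : Fin (n+1) // a ≠ i ∧ a ≠ j} => o.elim w (fun a => z a.1)) ∘ e := by
  obtain ⟨e, he⟩ := exists_eqv j i hij.symm z
  refine ⟨e.trans (Equiv.optionCongr (Equiv.subtypeEquivRight (fun a => and_comm))), fun w => ?_⟩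
  rw [he]
  funext k
  simp only [Function.comp_apply, Equiv.trans_apply, Equiv.optionCongr_apply]
  cases e k <;> rfl

lemma pair_main {F : LatticeCountFamily} {W : (g n : ℕ) → (Fin n → ℂ) → ℂ} (hW : WSpec F W)
    (g n : ℕ) (h : 4 ≤ 2 * g + (n + 1)) (z : Fin (n + 1) → ℂ)
    (hz : ∀ i, 0 < ‖z i‖ ∧ ‖z i‖ < 1) (hdist : Function.Injective z) (i j : Fin (n+1)) (hij : i ≠ j) :
    HasSum (fun b : Fin (n+1) → ℕ => TT F g b i j * XX z b)
      (deriv (fun w => 2 / z j * (w ^ 3 / (1 - w ^ 2) ^ 2) *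
            W g n (Function.update z i w ∘ Fin.succAbove j)) (z i)
          + deriv (fun w => 2 / z i * (w ^ 3 / (1 - w ^ 2) ^ 2) *
              W g n (Function.update z j w ∘ Fin.succAbove i)) (z j)
          + 2 * deriv (fun w => deriv (fun v =>
              v / (w - v) * (w ^ 3 / (1 - w ^ 2) ^ 2) *
                W g n (Function.update (Function.update z i w) j v ∘ Fin.succAbove j)
              - w / (w - v) * (v ^ 3 / (1 - v ^ 2) ^ 2) *
                W g n (Function.update (Function.update z i w) j v ∘ Fin.succAbove i))
              (z j)) (z i)) := by
  let β := {a : Fin (n+1) // a ≠ i ∧ a ≠ j} → ℕ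
  let t : {a : Fin (n+1) // a ≠ i ∧ a ≠ j} → ℂ := fun a => z a.1
  let M : ℕ → β → ℂ := fun p b => (F.N g (Option {a : Fin (n+1) // a ≠ i ∧ a ≠ j})
                  (fun x => Option.elim x p b) : ℂ) * (br p * XX t b)
  let D : ℕ → β → ℂ := fun s b => ∑ p ∈ Finset.range (s + 1), evn (s - p) * M p b
  have base : ∀ e : Fin n ≃ Option {a : Fin (n+1) // a ≠ i ∧ a ≠ j}, ∀ w : ℂ, 0 < ‖w‖ → ‖w‖ < 1 →
      HasSum (fun x : ℕ × β => D x.1 x.2 * w ^ x.1) (2 * (w ^ 3 / (1 - w ^ 2) ^ 2) *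
        W g n ((fun o : Option {a : Fin (n+1) // a ≠ i ∧ a ≠ j} => o.elim w t) ∘ e)) := by
    intro e w hw hw'
    have h0 := hasSum_opt hW g n (by omega) e t (fun a => hz _) w hw hw'
    have h1 := hasSum_push2 M _ w hw' (hs_congr h0 (fun x => by simp only [M]; ring) rfl)
    refine hs_congr h1 (fun x => rfl) ?_
    ring
  obtain ⟨e1, he1⟩ := exists_eqv i j hij z
  obtain ⟨e2, he2⟩ := exists_eqv' i j hij z
  have key := hasSum_pair D (fun b => by simp [D, evn]) 
    (fun w => 2 * (w ^ 3 / (1 - w ^ 2) ^ 2) * W g n (Function.update z i w ∘ Fin.succAbove j))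
    (fun w => 2 * (w ^ 3 / (1 - w ^ 2) ^ 2) * W g n (Function.update z j w ∘ Fin.succAbove i))
    (fun w h h' => by rw [he1]; exact base e1 w h h')
    (fun w h h' => by rw [he2]; exact base e2 w h h')
    (z i) (z j) (hz i).1 (hz i).2 (hz j).1 (hz j).2 (fun hc => hij (hdist hc))
  let E : (Fin (n+1) → ℕ) ≃ ℕ × ℕ × β :=
    { toFun := fun b => (b i, b j, fun a => b a.1)
      invFun := fun x a => if hi : a = i then x.1 else if hj : a = j then x.2.1 else x.2.2 ⟨a, hi, hj⟩
      left_inv := fun b => by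
        funext a
        by_cases hi : a = i
        · subst hi; simp
        · by_cases hj : a = j
          · subst hj; simp [hi]
          · simp [hi, hj]
      right_inv := fun x => by
        refine Prod.ext (by simp) (Prod.ext (by simp [hij.symm]) ?_)
        funext a
        simp [a.2.1, a.2.2] }
  rw [← E.hasSum_iff] at key
  refine hs_congr key (fun b => ?_) ?_
  · rw [XX_double z b i j hij]
    change _ = (∑ p ∈ Finset.range (b i + b j + 1), evn (b i + b j - p) * M p (fun a => b a.1)) * _
    unfold TT
    rw [Finset.sum_mul, Finset.sum_mul]
    refine Finset.sum_congr rfl fun p _ => ?_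
    simp only [M, t, E, Equiv.coe_fn_mk]
    ring
  · have u1 : ∀ w v, Function.update (Function.update z i w) j v ∘ Fin.succAbove j =
        Function.update z i w ∘ Fin.succAbove j := by
      intro w v; funext k; simp [Fin.succAbove_ne]
    have u2 : ∀ w v, Function.update (Function.update z i w) j v ∘ Fin.succAbove i =
        Function.update z j v ∘ Fin.succAbove i := by
      intro w v; rw [Function.update_comm hij]; funext k; simp [Fin.succAbove_ne]
    simp only [u1, u2]
    congr 1
    · congr 1
      · congr 1; funext w; ring
      · congr 1; funext w; ring
    · rw [← deriv_const_mul_field]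
      congr 1; funext w
      rw [← deriv_const_mul_field]
      congr 1; funext v
      ring

noncomputable def MM (F : LatticeCountFamily) (g : ℕ) {n : ℕ} (i : Fin (n+1)) (p q : ℕ)
    (b : {a : Fin (n+1) // a ≠ i} → ℕ) : ℂ :=
  (if g = 0 then 0 else
    (F.N (g - 1) (Option (Option {a : Fin (n+1) // a ≠ i}))
      (fun x => Option.elim x p (fun y => Option.elim y q b)) : ℂ))
  + ∑ g₁ ∈ Finset.range (g + 1),
      ∑ I ∈ (Finset.univ : Finset {a : Fin (n+1) // a ≠ i}).powerset,
        (if 3 ≤ 2 * g₁ + (I.card + 1) ∧ 3 ≤ 2 * (g - g₁) + (Iᶜ.card + 1) then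
          (F.N g₁ (Option {x : {a : Fin (n+1) // a ≠ i} // x ∈ I})
            (fun x => Option.elim x p (fun a => b a.1)) : ℂ) *
          (F.N (g - g₁) (Option {x : {a : Fin (n+1) // a ≠ i} // x ∈ Iᶜ})
            (fun x => Option.elim x q (fun a => b a.1)) : ℂ)
         else 0)

noncomputable def SS (F : LatticeCountFamily) (g : ℕ) {n : ℕ} (b : Fin (n+1) → ℕ) (i : Fin (n+1)) : ℂ :=
  ∑ p ∈ Finset.range (b i + 1), ∑ q ∈ Finset.range (b i - p + 1),
    evn (b i - p - q) * ((br p : ℂ) * (br q : ℂ) * MM F g i p q (fun a => b a.1))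

noncomputable def VV (W : (g n : ℕ) → (Fin n → ℂ) → ℂ) (g n : ℕ) (z : Fin (n + 1) → ℂ)
    (i : Fin (n+1)) (w : ℂ) : ℂ :=
  ((if g = 0 then 0 else
                W (g - 1) (n + 2)
                  (Fin.cons w (Fin.cons w (z ∘ Fin.succAbove i))))
              + ∑ g₁ ∈ Finset.range (g + 1),
                  ∑ I ∈ ((Finset.univ : Finset (Fin (n + 1))).erase i).powerset,
                    (if 3 ≤ 2 * g₁ + (I.card + 1) ∧
                        3 ≤ 2 * (g - g₁) +
                          ((((Finset.univ : Finset (Fin (n + 1))).erase i) \ I).card + 1) then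
                      W g₁ (I.card + 1) (Fin.cons w (restr z I)) *
                      W (g - g₁)
                        ((((Finset.univ : Finset (Fin (n + 1))).erase i) \ I).card + 1)
                        (Fin.cons w (restr z (((Finset.univ : Finset (Fin (n + 1))).erase i) \ I)))
                     else 0))

def subEqv {n : ℕ} (i : Fin (n+1)) (I : Finset (Fin (n+1))) (I' : Finset {a : Fin (n+1) // a ≠ i})
    (hi : i ∉ I) (hI : ∀ a : {a : Fin (n+1) // a ≠ i}, a.1 ∈ I ↔ a ∈ I') :
    {x // x ∈ I} ≃ {x // x ∈ I'} where
  toFun x := ⟨⟨x.1, fun h => hi (h ▸ x.2)⟩, (hI _).1 x.2⟩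
  invFun y := ⟨y.1.1, (hI _).2 y.2⟩
  left_inv x := rfl
  right_inv y := rfl

lemma restr_eqv {n : ℕ} (i : Fin (n+1)) (I : Finset (Fin (n+1))) (I' : Finset {a : Fin (n+1) // a ≠ i})
    (hi : i ∉ I) (hI : ∀ a : {a : Fin (n+1) // a ≠ i}, a.1 ∈ I ↔ a ∈ I') (z : Fin (n+1) → ℂ) (w : ℂ) :
    ∃ e : Fin (I.card + 1) ≃ Option {x // x ∈ I'},
      (Fin.cons w (restr z I) : Fin (I.card + 1) → ℂ) =
        (fun o : Option {x // x ∈ I'} => o.elim w (fun a => z a.1.1)) ∘ e := by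
  refine ⟨(finSuccEquiv _).trans (Equiv.optionCongr
    ((I.orderIsoOfFin rfl).toEquiv.trans (subEqv i I I' hi hI))), ?_⟩
  funext k
  refine Fin.cases ?_ (fun k => ?_) k
  · simp
  · simp [restr, subEqv]

lemma opt2_eqv {n : ℕ} (i : Fin (n+1)) (z : Fin (n+1) → ℂ) (w : ℂ) :
    ∃ e : Fin (n + 2) ≃ Option (Option {a : Fin (n+1) // a ≠ i}),
      (Fin.cons w (Fin.cons w (z ∘ Fin.succAbove i) : Fin (n+1) → ℂ) : Fin (n + 2) → ℂ) =
        (fun o : Option (Option {a : Fin (n+1) // a ≠ i}) => o.elim w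
          (fun y => y.elim w (fun a => z a.1))) ∘ e := by
  refine ⟨(finSuccEquiv _).trans (Equiv.optionCongr ((finSuccEquiv _).trans (Equiv.optionCongr
    (finSuccAboveEquiv i)))), ?_⟩
  funext k
  refine Fin.cases ?_ (fun k => ?_) k
  · simp
  · refine Fin.cases ?_ (fun k => ?_) k
    · rfl
    · simp
      rfl

lemma MM_hasSum {F : LatticeCountFamily} {W : (g n : ℕ) → (Fin n → ℂ) → ℂ} (hW : WSpec F W)
    (g n : ℕ) (h : 4 ≤ 2 * g + (n + 1)) (z : Fin (n + 1) → ℂ)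
    (hz : ∀ i, 0 < ‖z i‖ ∧ ‖z i‖ < 1) (i : Fin (n+1)) (w : ℂ) (hw : 0 < ‖w‖) (hw1 : ‖w‖ < 1) :
    HasSum (fun x : ℕ × ℕ × ({a : Fin (n+1) // a ≠ i} → ℕ) => MM F g i x.1 x.2.1 x.2.2 *
      ((br x.1 * w ^ x.1) * (br x.2.1 * w ^ x.2.1) * XX (fun a : {a // a ≠ i} => z a.1) x.2.2))
      (w ^ 2 * VV W g n z i w) := by
  let t : {a // a ≠ i} → ℂ := fun a => z a.1
  have hE : ∀ (G : Finset (Fin (n+1)) → ℂ),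
      ∑ I ∈ ((Finset.univ : Finset (Fin (n + 1))).erase i).powerset, G I =
      ∑ I' ∈ (Finset.univ : Finset {a : Fin (n+1) // a ≠ i}).powerset,
        G (I'.map (Function.Embedding.subtype _)) := by
    intro G
    symm
    refine Finset.sum_bij (fun I' _ => I'.map (Function.Embedding.subtype _)) ?_ ?_ ?_ ?_
    · intro I' _
      rw [Finset.mem_powerset]
      intro a ha
      simp only [Finset.mem_map, Function.Embedding.subtype_apply] at ha
      obtain ⟨x, hx, rfl⟩ := ha
      simp [x.2]
    · intro a _ b _ hab
      exact Finset.map_injective _ hab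
    · intro I hI
      refine ⟨I.subtype (fun a => a ≠ i), by simp, ?_⟩
      rw [Finset.subtype_map]
      refine Finset.filter_true_of_mem fun x hx => ?_
      have := Finset.mem_powerset.1 hI hx
      simpa using this
    · intros; rfl
  unfold MM VV
  simp only [hE, add_mul, mul_add, Finset.sum_mul, Finset.mul_sum]
  refine HasSum.add ?_ (hasSum_sum fun g₁ _ => hasSum_sum fun I' _ => ?_)
  · by_cases hg : g = 0
    · simp only [hg, if_true, zero_mul, mul_zero]; exact hasSum_zero
    · simp only [hg, if_false]
      obtain ⟨e, he⟩ := opt2_eqv i z w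
      rw [he]
      exact hasSum_opt2 hW (g-1) (n+2) (by omega) e t (fun a => hz _) w hw hw1
  · have hi1 : i ∉ I'.map (Function.Embedding.subtype _) := by simp
    have hI1 : ∀ a : {a : Fin (n+1) // a ≠ i}, a.1 ∈ I'.map (Function.Embedding.subtype _) ↔ a ∈ I' := by
      intro a; simp [a.2]
    have hi2 : i ∉ (Finset.univ : Finset (Fin (n + 1))).erase i \ I'.map (Function.Embedding.subtype _) := by simp
    have hI2 : ∀ a : {a : Fin (n+1) // a ≠ i}, a.1 ∈ (Finset.univ : Finset (Fin (n + 1))).erase i \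
        I'.map (Function.Embedding.subtype _) ↔ a ∈ I'ᶜ := by
      intro a; simp [a.2]
    generalize I'.map (Function.Embedding.subtype _) = I at *
    generalize (Finset.univ : Finset (Fin (n + 1))).erase i \ I = J at *
    have c1 : I.card = I'.card := by
      simpa using Fintype.card_congr (subEqv i I I' hi1 hI1)
    have c2 : J.card = I'ᶜ.card := by
      rw [← Fintype.card_coe J, ← Fintype.card_coe I'ᶜ]
      exact Fintype.card_congr (subEqv i J I'ᶜ hi2 hI2)
    obtain ⟨e1, he1⟩ := restr_eqv i I I' hi1 hI1 z w
    obtain ⟨e2, he2⟩ := restr_eqv i J I'ᶜ hi2 hI2 z w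
    rw [he1, he2]
    rw [← c1, ← c2]
    by_cases hc : 3 ≤ 2 * g₁ + (I.card + 1) ∧ 3 ≤ 2 * (g - g₁) + (J.card + 1)
    · simp only [hc, and_self, if_true]
      exact hasSum_prod hW I' g₁ _ hc.1 (g - g₁) _ hc.2 e1 e2 t (fun a => hz _) w hw hw1
    · simp only [hc, if_false, zero_mul, mul_zero]; exact hasSum_zero

lemma single_main {F : LatticeCountFamily} {W : (g n : ℕ) → (Fin n → ℂ) → ℂ} (hW : WSpec F W)
    (g n : ℕ) (h : 4 ≤ 2 * g + (n + 1)) (z : Fin (n + 1) → ℂ)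
    (hz : ∀ i, 0 < ‖z i‖ ∧ ‖z i‖ < 1) (i : Fin (n+1)) :
    HasSum (fun b : Fin (n+1) → ℕ => 1 / 2 * SS F g b i * XX z b)
      (deriv (fun w => w ^ 4 / (1 - w ^ 2) ^ 2 * VV W g n z i w) (z i)) := by
  have key : ∀ w : ℂ, 0 < ‖w‖ → ‖w‖ < 1 → HasSum (fun b : Fin (n+1) → ℕ =>
      (1 / 2 * SS F g b i * XX (fun a : {a // a ≠ i} => z a.1) (fun a => b a.1)) * w ^ (b i))
      (w ^ 4 / (1 - w ^ 2) ^ 2 * VV W g n z i w) := by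
    intro w hw hw'
    have h0 := MM_hasSum hW g n h z hz i w hw hw'
    have h1 := (hasSum_push3 (fun p q b => MM F g i p q b * (br p * br q *
      XX (fun a : {a // a ≠ i} => z a.1) b)) _ w hw' (hs_congr h0 (fun x => by ring) rfl)).mul_left (1/2)
    rw [← (Equiv.funSplitAt i ℕ).hasSum_iff] at h1
    refine hs_congr h1 (fun b => ?_) (by ring)
    simp only [Function.comp_apply, Equiv.funSplitAt_apply]
    unfold SS
    simp only [Finset.mul_sum, Finset.sum_mul]
    refine Finset.sum_congr rfl fun p _ => Finset.sum_congr rfl fun q _ => ?_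
    ring
  have := termwise_deriv _ _ _ (z i) (hz i).2 (fun w h h' => (key w h h').summable)
    ((disc_nhds _ (hz i).1 (hz i).2).mono fun w hw => key w hw.1 hw.2)
  refine hs_congr this (fun b => ?_) rfl
  rw [XX_single z b i]
  rcases hb : b i with _ | k
  · have : SS F g b i = 0 := by
      unfold SS; rw [hb]; simp [evn]
    simp [this]
  · have a1 : ((k + 1 : ℕ) : ℤ) - 1 = (k : ℤ) := by push_cast; ring
    simp only [a1, zpow_natCast, br]
    simp
    ring

lemma TT_symm (F : LatticeCountFamily) (g : ℕ) {n : ℕ} (b : Fin (n+1) → ℕ) (i j : Fin (n+1)) :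
    TT F g b i j = TT F g b j i := by
  unfold TT
  rw [add_comm (b i) (b j)]
  refine Finset.sum_congr rfl fun p _ => ?_
  congr 3
  have := F.symm g _ _ (Equiv.optionCongr (Equiv.subtypeEquivRight
    (fun a : Fin (n+1) => (and_comm : a ≠ i ∧ a ≠ j ↔ a ≠ j ∧ a ≠ i))))
    (fun x => Option.elim x p (fun a => b a.1))
  rw [← this]
  congr 1
  funext o
  cases o <;> rfl

lemma rec_complex (F : LatticeCountFamily) (g n : ℕ) (h : 4 ≤ 2 * g + (n + 1)) (b : Fin (n+1) → ℕ) :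
    (∑ i, (b i : ℂ)) * (F.N g (Fin (n+1)) b : ℂ) =
      (∑ i, ∑ j ∈ Finset.univ.filter (fun j => i < j), TT F g b i j) + ∑ i, 1 / 2 * SS F g b i := by
  have h0 := congrArg (Rat.cast : ℚ → ℂ) (F.recursion g (Fin (n+1)) (by simpa using h) b)
  have hT : (∑ i, ∑ j ∈ Finset.univ.filter (fun j => i < j), TT F g b i j) =
      1 / 2 * ∑ i, ∑ j ∈ Finset.univ.filter (fun j => j ≠ i), TT F g b i j := by
    have e1 : ∀ i : Fin (n+1), ∑ j ∈ Finset.univ.filter (fun j => j ≠ i), TT F g b i j =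
        (∑ j, if i < j then TT F g b i j else 0) + ∑ j, if j < i then TT F g b i j else 0 := by
      intro i
      rw [Finset.sum_filter, ← Finset.sum_add_distrib]
      refine Finset.sum_congr rfl fun j _ => ?_
      rcases lt_trichotomy i j with hl | hl | hl
      · simp [hl, hl.ne', hl.not_gt]
      · simp [hl]
      · simp [hl, hl.ne, hl.not_gt]
    simp only [e1, Finset.sum_add_distrib, Finset.sum_filter]
    have e2 : (∑ i : Fin (n+1), ∑ j, if j < i then TT F g b i j else 0) =
        ∑ i, ∑ j, if i < j then TT F g b i j else 0 := by
      rw [Finset.sum_comm]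
      refine Finset.sum_congr rfl fun i _ => Finset.sum_congr rfl fun j _ => ?_
      split_ifs
      · exact TT_symm F g b _ _
      · rfl
    rw [e2]; ring
  rw [hT, ← Finset.mul_sum]
  have e1 : ∀ i j : Fin (n+1), TT F g b i j = ((∑ p ∈ Finset.range (b i + b j + 1),
            (if Even (b i + b j - p) then
              (br p : ℚ) * ((b i + b j - p : ℕ) : ℚ) *
                F.N g (Option {a : Fin (n+1) // a ≠ i ∧ a ≠ j})
                  (fun x => Option.elim x p (fun a => b a.1))
             else 0) : ℚ) : ℂ) := by
    intro i j
    unfold TT evn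
    rw [Rat.cast_sum]
    refine Finset.sum_congr rfl fun p _ => ?_
    split_ifs
    · push_cast; ring
    · simp
  have e2 : ∀ i : Fin (n+1), SS F g b i = ((∑ p ∈ Finset.range (b i + 1), ∑ q ∈ Finset.range (b i - p + 1),
            (if Even (b i - p - q) then
              (br p : ℚ) * (br q : ℚ) * ((b i - p - q : ℕ) : ℚ) *
                ((if g = 0 then 0 else
                    F.N (g - 1) (Option (Option {a : Fin (n+1) // a ≠ i}))
                      (fun x => Option.elim x p
                        (fun y => Option.elim y q (fun a => b a.1))))
                  + ∑ g₁ ∈ Finset.range (g + 1),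
                      ∑ I ∈ (Finset.univ : Finset {a : Fin (n+1) // a ≠ i}).powerset,
                        (if 3 ≤ 2 * g₁ + (I.card + 1) ∧ 3 ≤ 2 * (g - g₁) + (Iᶜ.card + 1) then
                          F.N g₁ (Option {x : {a : Fin (n+1) // a ≠ i} // x ∈ I})
                            (fun x => Option.elim x p (fun a => b a.1.1)) *
                          F.N (g - g₁) (Option {x : {a : Fin (n+1) // a ≠ i} // x ∈ Iᶜ})
                            (fun x => Option.elim x q (fun a => b a.1.1))
                         else 0))
             else 0) : ℚ) : ℂ) := by
    intro i
    unfold SS evn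
    rw [Rat.cast_sum]
    refine Finset.sum_congr rfl fun p _ => ?_
    rw [Rat.cast_sum]
    refine Finset.sum_congr rfl fun q _ => ?_
    by_cases hE : Even (b i - p - q)
    · rw [if_pos hE, if_pos hE, Rat.cast_mul]
      have e3 : ∀ x y : ℂ, x = y → ((b i - p - q : ℕ) : ℂ) * ((br p : ℂ) * (br q : ℂ) * x) =
        (((br p : ℚ) * (br q : ℚ) * ((b i - p - q : ℕ) : ℚ) : ℚ) : ℂ) * y := by
        rintro x y rfl
        push_cast; ring
      apply e3
      unfold MM
      rw [Rat.cast_add, Rat.cast_sum]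
      congr 1
      · split_ifs
        · simp
        · rfl
      · refine Finset.sum_congr rfl fun g₁ _ => ?_
        rw [Rat.cast_sum]
        refine Finset.sum_congr rfl fun I _ => ?_
        split_ifs
        · rw [Rat.cast_mul]
        · simp
    · rw [if_neg hE, if_neg hE]; simp
  simp only [e1, e2]
  rw [Rat.cast_mul, Rat.cast_add, Rat.cast_mul, Rat.cast_mul, Rat.cast_sum, Rat.cast_sum, Rat.cast_sum] at h0
  simp only [Rat.cast_sum (Finset.univ.filter _)] at h0
  push_cast at h0 ⊢
  exact h0


/-- The combinatorial recursion for the lattice point count of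
$\overline{\mathcal M}_{g,n}$, expressed in terms of the generating functions
$W_{g,n}(z_1,\dots,z_n)=\sum_b \overline N_{g,n}(b)\prod_i [b_i]z_i^{b_i-1}$
(Proposition: symmetric form).  Here there are `n + 1` variables, and the
hypothesis `hW` says that `W` sums the defining series on the punctured unit
polydisc. -/
theorem recursion_generating_functions (Nfam : LatticeCountFamily)
    (W : (g n : ℕ) → (Fin n → ℂ) → ℂ)
    (hW : ∀ g n : ℕ, 3 ≤ 2 * g + n → ∀ z : Fin n → ℂ,
      (∀ i, 0 < ‖z i‖ ∧ ‖z i‖ < 1) →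
      HasSum
        (fun b : Fin n → ℕ => (Nfam.N g (Fin n) b : ℂ) *
          ∏ i, (br (b i) : ℂ) * z i ^ ((b i : ℤ) - 1))
        (W g n z))
    (g n : ℕ) (h : 4 ≤ 2 * g + (n + 1)) (z : Fin (n + 1) → ℂ)
    (hz : ∀ i, 0 < ‖z i‖ ∧ ‖z i‖ < 1) (hdist : Function.Injective z) :
    ∑ i, deriv (fun w => w * W g (n + 1) (Function.update z i w)) (z i) =
      (∑ i, ∑ j ∈ Finset.univ.filter (fun j => i < j),
        (deriv (fun w => 2 / z j * (w ^ 3 / (1 - w ^ 2) ^ 2) *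
            W g n (Function.update z i w ∘ Fin.succAbove j)) (z i)
          + deriv (fun w => 2 / z i * (w ^ 3 / (1 - w ^ 2) ^ 2) *
              W g n (Function.update z j w ∘ Fin.succAbove i)) (z j)
          + 2 * deriv (fun w => deriv (fun v =>
              v / (w - v) * (w ^ 3 / (1 - w ^ 2) ^ 2) *
                W g n (Function.update (Function.update z i w) j v ∘ Fin.succAbove j)
              - w / (w - v) * (v ^ 3 / (1 - v ^ 2) ^ 2) *
                W g n (Function.update (Function.update z i w) j v ∘ Fin.succAbove i))
              (z j)) (z i)))
      + ∑ i, deriv (fun w =>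
          w ^ 4 / (1 - w ^ 2) ^ 2 *
            ((if g = 0 then 0 else
                W (g - 1) (n + 2)
                  (Fin.cons w (Fin.cons w (z ∘ Fin.succAbove i))))
              + ∑ g₁ ∈ Finset.range (g + 1),
                  ∑ I ∈ ((Finset.univ : Finset (Fin (n + 1))).erase i).powerset,
                    (if 3 ≤ 2 * g₁ + (I.card + 1) ∧
                        3 ≤ 2 * (g - g₁) +
                          ((((Finset.univ : Finset (Fin (n + 1))).erase i) \ I).card + 1) then
                      W g₁ (I.card + 1) (Fin.cons w (restr z I)) *
                      W (g - g₁)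
                        ((((Finset.univ : Finset (Fin (n + 1))).erase i) \ I).card + 1)
                        (Fin.cons w (restr z (((Finset.univ : Finset (Fin (n + 1))).erase i) \ I)))
                     else 0))) (z i) := by

  have hW' : WSpec Nfam W := hW
  have hL : HasSum (fun b : Fin (n+1) → ℕ => ∑ i, (b i : ℂ) * (Nfam.N g (Fin (n+1)) b : ℂ) * XX z b) _ :=
    hasSum_sum fun i _ => lhs_hasSum hW' g n h z hz i
  refine hL.unique ?_
  have h1 : HasSum (fun b : Fin (n+1) → ℕ => ∑ i, ∑ j ∈ Finset.univ.filter (fun j => i < j),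
      TT Nfam g b i j * XX z b) _ :=
    hasSum_sum fun i _ => hasSum_sum fun j hj =>
      pair_main hW' g n h z hz hdist i j (Finset.mem_filter.1 hj).2.ne
  have h2 : HasSum (fun b : Fin (n+1) → ℕ => ∑ i, 1 / 2 * SS Nfam g b i * XX z b) _ :=
    hasSum_sum fun i _ => single_main hW' g n h z hz i
  refine hs_congr (h1.add h2) (fun b => ?_) rfl
  simp only [← Finset.sum_mul]
  rw [rec_complex Nfam g n h b, add_mul]
end

section
/- Let N be a lattice-count family and, for (g,n) with 2g−2+n ≥ 1, let W_{g,n}(z₁,…,zₙ) denote the sum of the series ∑_{b∈ℕⁿ} N_{g,n}(b)·∏ᵢ [bᵢ]·zᵢ^{bᵢ−1} on the punctured unit polydisc; for (g,n) with 2g−2+n ≥ 2 let A_{g,n}(z₂,…,zₙ) denote the sum of the (convergent) series ∑_{(b₂,…,bₙ)∈ℕ^{n−1}} N_{g,n}(0,b₂,…,bₙ)·∏_{j=2}^n [b_j]·z_j^{b_j−1}. Then for every (g,n) with 2g−2+n ≥ 2 and all pairwise distinct z₁,…,zₙ with 0 < |zᵢ| < 1, writing S = {2,…,n} and ∂_j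 for the complex partial derivative with respect to z_j: W_{g,n}(z₁,z_S) − A_{g,n}(z_S)/z₁ = ∑_{j=2}^n ( 2/(z₁·z_j) + 1/(z₁−z_j)² + 1/(1−z₁z_j)² )·( z₁³/(1−z₁²)² )·W_{g,n−1}(z₁, z_{S∖{j}}) − ∑_{j=2}^n ∂_j[ ( 1/(z₁−z_j) + z_j/(1−z₁z_j) )·( z_j³/(1−z_j²)² )·W_{g,n−1}(z_S) ] + ( z₁³/(1−z₁²)² )·( W_{g−1,n+1}(z₁,z₁,z_S) + ∑_{g₁+g₂=g, I⊔J=S} W_{g₁,|I|+1}(z₁,z_I)·W_{g₂,|J|+1}(z₁,z_J) ), where the W_{g−1,n+1} term is omitted when g = 0 and the last sum is over ordered pairs (g₁,I),(g₂,J), omitting all terms with (g₁,|I|+1) or (g₂,|J|+1) equal to (0,1) or (0,2). -/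
open scoped BigOperators

lemma sum_range_two_mul' {M : Type*} [AddCommMonoid M] (g : ℕ → M) (n : ℕ) :
    ∑ j ∈ Finset.range (2 * n), g j = ∑ i ∈ Finset.range n, (g (2 * i) + g (2 * i + 1)) := by
  induction n with
  | zero => simp
  | succ n ih =>
    rw [show 2 * (n + 1) = 2 * n + 1 + 1 by ring, Finset.sum_range_succ, Finset.sum_range_succ, ih,
      Finset.sum_range_succ, add_assoc]

lemma odd_binom {R : Type*} [CommRing R] (x y : R) (m : ℕ) :
    (x + y) ^ (2 * m + 1) + (x - y) ^ (2 * m + 1) =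
      2 * ∑ i ∈ Finset.range (m + 1), ((2 * m + 1).choose (2 * i + 1) : R) * x ^ (2 * i + 1) * y ^ (2 * (m - i)) := by
  rw [sub_eq_add_neg, add_pow, add_pow, ← Finset.sum_add_distrib,
    show 2 * m + 1 + 1 = 2 * (m + 1) by ring, sum_range_two_mul', Finset.mul_sum]
  refine Finset.sum_congr rfl fun i hi => ?_
  have hi' : i ≤ m := by simpa [Nat.lt_succ_iff] using hi
  obtain ⟨d, rfl⟩ := Nat.exists_eq_add_of_le hi'
  have h1 : 2 * (i + d) + 1 - 2 * i = 2 * d + 1 := by omega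
  have h2 : 2 * (i + d) + 1 - (2 * i + 1) = 2 * d := by omega
  have h3 : 2 * (i + d - i) = 2 * d := by omega
  have h4 : (-y) ^ (2 * d + 1) = - y ^ (2 * d + 1) := Odd.neg_pow ⟨d, rfl⟩ y
  have h5 : (-y) ^ (2 * d) = y ^ (2 * d) := Even.neg_pow ⟨d, by ring⟩ y
  rw [h1, h2, h3, h4, h5]
  ring

open PowerSeries in
noncomputable def Kp (m π : ℕ) : PowerSeries ℚ :=
  PowerSeries.mk fun k => if k % 2 = π then (k : ℚ) ^ (2 * m + 1) else 0

noncomputable def Asp : Submodule ℚ (PowerSeries ℚ) :=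
  Submodule.span ℚ {F | ∃ m π : ℕ, π < 2 ∧ F = Kp m π}

lemma Kp_mem {m π : ℕ} (hπ : π < 2) : Kp m π ∈ Asp := Submodule.subset_span ⟨m, π, hπ, rfl⟩

lemma C_two : (PowerSeries.C 2 : PowerSeries ℚ) = 2 := map_ofNat _ 2

lemma coeff_Kp (m π k : ℕ) : PowerSeries.coeff k (Kp m π) = if k % 2 = π then (k : ℚ) ^ (2 * m + 1) else 0 := by
  simp [Kp]

lemma coeff_sq_mul' (f : ℕ → ℚ) (F : PowerSeries ℚ) (hF : F = PowerSeries.mk f) (k : ℕ) :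
    PowerSeries.coeff k ((1 - PowerSeries.X ^ 2) ^ 2 * F) =
      f k - 2 * (if 2 ≤ k then f (k - 2) else 0) + (if 4 ≤ k then f (k - 4) else 0) := by
  have : (1 - PowerSeries.X ^ 2) ^ 2 * F = F - PowerSeries.C 2 * (PowerSeries.X ^ 2 * F) + PowerSeries.X ^ 4 * F := by
    have : (PowerSeries.C (2:ℚ)) = 2 := C_two
    rw [this]; ring
  rw [this]
  simp only [map_add, map_sub, PowerSeries.coeff_X_pow_mul', PowerSeries.coeff_C_mul, hF, PowerSeries.coeff_mk]

lemma coeff_sq_mul (m π k : ℕ) :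
    PowerSeries.coeff k ((1 - PowerSeries.X ^ 2) ^ 2 * Kp m π) =
      (if k % 2 = π then (k : ℚ) ^ (2 * m + 1) else 0) - 2 * (if 2 ≤ k then (if (k - 2) % 2 = π then ((k - 2 : ℕ) : ℚ) ^ (2 * m + 1) else 0) else 0) + (if 4 ≤ k then (if (k - 4) % 2 = π then ((k - 4 : ℕ) : ℚ) ^ (2 * m + 1) else 0) else 0) :=
  coeff_sq_mul' _ _ rfl k

lemma one_sub_ne : ((1 - PowerSeries.X ^ 2) ^ 2 : PowerSeries ℚ) ≠ 0 := by
  intro h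
  have := congrArg (PowerSeries.coeff 0) h
  simp at this

lemma E_eq : (1 - PowerSeries.X ^ 2) ^ 2 * Kp 0 0 = 2 * PowerSeries.X ^ 2 := by
  ext k
  rw [coeff_sq_mul, show (2 : PowerSeries ℚ) = PowerSeries.C 2 from C_two.symm, PowerSeries.coeff_C_mul,
    PowerSeries.coeff_X_pow]
  match k with
  | 0 => simp
  | 1 => simp
  | 2 => simp
  | 3 => simp
  | k + 4 =>
    have h1 : (k + 4) % 2 = k % 2 := by omega
    have h2 : (k + 4 - 2) % 2 = k % 2 := by omega
    have h3 : k + 4 - 2 = k + 2 := by omega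
    simp [h1]
    split_ifs <;> ring

lemma O_eq : (1 - PowerSeries.X ^ 2) ^ 2 * Kp 0 1 = PowerSeries.X + PowerSeries.X ^ 3 := by
  ext k
  rw [coeff_sq_mul, map_add, PowerSeries.coeff_X_pow, PowerSeries.coeff_X]
  match k with
  | 0 => simp
  | 1 => simp
  | 2 => simp
  | 3 => norm_num
  | k + 4 =>
    have h1 : (k + 4) % 2 = k % 2 := by omega
    simp [h1]
    split_ifs <;> ring

/-- coefficients of the second difference -/
def cc (m i : ℕ) : ℚ := 2 * ((2 * m + 3).choose (2 * i + 1) : ℚ) * 2 ^ (2 * (m + 1 - i))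

lemma cc_ne (m : ℕ) : cc m m ≠ 0 := by
  unfold cc
  have : (2 * m + 3).choose (2 * m + 1) ≠ 0 := Nat.pos_iff_ne_zero.mp (Nat.choose_pos (by omega))
  positivity

lemma second_diff (x : ℚ) (m : ℕ) :
    (x + 2) ^ (2 * m + 3) + (x - 2) ^ (2 * m + 3) - 2 * x ^ (2 * m + 3) =
      ∑ i ∈ Finset.range (m + 1), cc m i * x ^ (2 * i + 1) := by
  have := odd_binom x 2 (m + 1)
  rw [show 2 * m + 3 = 2 * (m + 1) + 1 by ring, this, Finset.sum_range_succ, mul_add, Finset.mul_sum]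
  simp only [Nat.choose_self, Nat.sub_self]
  have : ∀ i, 2 * (((2 * (m + 1) + 1).choose (2 * i + 1) : ℚ) * x ^ (2 * i + 1) * 2 ^ (2 * (m + 1 - i))) = cc m i * x ^ (2 * i + 1) := by
    intro i; unfold cc; rw [show 2 * m + 3 = 2 * (m + 1) + 1 by ring]; ring
  simp only [this]
  push_cast; ring

lemma Kp_sum_coeff (m π : ℕ) : (∑ i ∈ Finset.range (m + 1), PowerSeries.C (cc m i) * Kp i π) =
    PowerSeries.mk fun k => if k % 2 = π then ((k:ℚ) + 2) ^ (2 * m + 3) + ((k:ℚ) - 2) ^ (2 * m + 3) - 2 * (k:ℚ) ^ (2 * m + 3) else 0 := by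
  ext k
  simp only [map_sum, PowerSeries.coeff_C_mul, Kp, PowerSeries.coeff_mk]
  split_ifs with h
  · rw [second_diff]
  · simp

lemma Kp_succ (m π : ℕ) (hπ : π < 2) :
    2 * Kp (m + 1) π = Kp 0 0 * ∑ i ∈ Finset.range (m + 1), PowerSeries.C (cc m i) * Kp i π +
      PowerSeries.C (if π = 0 then 2 ^ (2 * m + 3) else 2) * Kp 0 π := by
  apply mul_left_cancel₀ one_sub_ne
  have e1 := E_eq
  have e2 := O_eq
  rw [mul_add, ← mul_assoc ((1 - PowerSeries.X ^ 2) ^ 2) (Kp 0 0), e1, Kp_sum_coeff]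
  have h2 : (2 : PowerSeries ℚ) = PowerSeries.C 2 := C_two.symm
  have key : (1 - PowerSeries.X ^ 2) ^ 2 * Kp (m+1) π = PowerSeries.X ^ 2 * (PowerSeries.mk fun k => if k % 2 = π then ((k:ℚ) + 2) ^ (2 * m + 3) + ((k:ℚ) - 2) ^ (2 * m + 3) - 2 * (k:ℚ) ^ (2 * m + 3) else 0) + PowerSeries.C (if π = 0 then 2 ^ (2 * m + 2) else 1) * ((1 - PowerSeries.X ^ 2) ^ 2 * Kp 0 π) := by
    ext k
    rw [coeff_sq_mul, map_add, PowerSeries.coeff_X_pow_mul', PowerSeries.coeff_C_mul, coeff_sq_mul, PowerSeries.coeff_mk]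
    have hm : (-2 : ℚ) ^ (2 * m + 3) = - 2 ^ (2 * m + 3) := Odd.neg_pow ⟨m + 1, by ring⟩ 2
    have hm' : (-1 : ℚ) ^ (2 * m + 3) = - 1 := by rw [Odd.neg_pow ⟨m + 1, by ring⟩]; simp
    interval_cases π
    · match k with
      | 0 => simp
      | 1 => simp
      | 2 => simp [hm]; ring
      | 3 => simp
      | k + 4 =>
        have h1 : (k + 4) % 2 = k % 2 := by omega
        simp [h1]
        split_ifs <;> ring
    · match k with
      | 0 => simp
      | 1 => simp
      | 2 => simp
      | 3 => norm_num [mul_add, hm']; ring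
      | k + 4 =>
        have h1 : (k + 4) % 2 = k % 2 := by omega
        simp [h1]
        split_ifs <;> ring
  have h3 : PowerSeries.C (if π = 0 then (2:ℚ) ^ (2 * m + 3) else 2) = 2 * PowerSeries.C (if π = 0 then 2 ^ (2 * m + 2) else 1) := by
    rw [h2, ← map_mul]; congr 1; split_ifs <;> ring
  rw [h3]
  linear_combination 2 * key

lemma C_mul_mem {F : PowerSeries ℚ} (c : ℚ) (hF : F ∈ Asp) : PowerSeries.C c * F ∈ Asp := by
  rw [← PowerSeries.smul_eq_C_mul]; exact Asp.smul_mem c hF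

lemma of_C_mul_mem {F : PowerSeries ℚ} (c : ℚ) (hc : c ≠ 0) (hF : PowerSeries.C c * F ∈ Asp) : F ∈ Asp := by
  have := C_mul_mem c⁻¹ hF
  rwa [← mul_assoc, ← map_mul, inv_mul_cancel₀ hc, map_one, one_mul] at this

lemma E_mul_Kp (m π : ℕ) (hπ : π < 2) : Kp 0 0 * Kp m π ∈ Asp := by
  induction m using Nat.strong_induction_on with
  | _ m ih =>
    have h := Kp_succ m π hπ
    rw [Finset.sum_range_succ, mul_add, Finset.mul_sum] at h
    apply of_C_mul_mem _ (cc_ne m)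
    have h' : PowerSeries.C (cc m m) * (Kp 0 0 * Kp m π) = PowerSeries.C 2 * Kp (m+1) π
        - ∑ i ∈ Finset.range m, PowerSeries.C (cc m i) * (Kp 0 0 * Kp i π)
        - PowerSeries.C (if π = 0 then 2 ^ (2 * m + 3) else 2) * Kp 0 π := by
      have h2 : (PowerSeries.C 2 : PowerSeries ℚ) = 2 := C_two
      rw [h2, h]
      have : ∀ i, Kp 0 0 * (PowerSeries.C (cc m i) * Kp i π) = PowerSeries.C (cc m i) * (Kp 0 0 * Kp i π) := by
        intro i; ring
      simp only [this]; ring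
    rw [h']
    refine Asp.sub_mem (Asp.sub_mem (C_mul_mem _ (Kp_mem hπ)) (Asp.sum_mem fun i hi => C_mul_mem _ (ih i (Finset.mem_range.mp hi)))) (C_mul_mem _ (Kp_mem hπ))

lemma mul_mem_of (G : PowerSeries ℚ) (h : ∀ m π, π < 2 → G * Kp m π ∈ Asp) {F : PowerSeries ℚ} (hF : F ∈ Asp) :
    G * F ∈ Asp := by
  unfold Asp at hF
  induction hF using Submodule.span_induction with
  | mem x hx => obtain ⟨m, π, hπ, rfl⟩ := hx; exact h m π hπ
  | zero => simp
  | add x y _ _ hx hy => rw [mul_add]; exact Asp.add_mem hx hy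
  | smul a x _ hx => rw [mul_smul_comm]; exact Asp.smul_mem a hx

lemma E_mul {F : PowerSeries ℚ} (hF : F ∈ Asp) : Kp 0 0 * F ∈ Asp :=
  mul_mem_of _ (fun m π h => E_mul_Kp m π h) hF

lemma G_mul_Kp (G : PowerSeries ℚ) (h0 : G * Kp 0 0 ∈ Asp) (h1 : G * Kp 0 1 ∈ Asp) (m π : ℕ) (hπ : π < 2) :
    G * Kp m π ∈ Asp := by
  induction m using Nat.strong_induction_on with
  | _ m ih =>
    have hb : G * Kp 0 π ∈ Asp := by interval_cases π <;> assumption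
    match m with
    | 0 => exact hb
    | m + 1 =>
      apply of_C_mul_mem 2 two_ne_zero
      have h2 : (PowerSeries.C 2 : PowerSeries ℚ) = 2 := C_two
      rw [h2, mul_left_comm, Kp_succ m π hπ, mul_add]
      refine Asp.add_mem ?_ ?_
      · rw [mul_left_comm]
        apply E_mul
        rw [Finset.mul_sum]
        refine Asp.sum_mem fun i hi => ?_
        rw [mul_left_comm]
        exact C_mul_mem _ (ih i (Finset.mem_range.mp hi))
      · rw [mul_left_comm]; exact C_mul_mem _ hb

lemma OO_mem : Kp 0 1 * Kp 0 1 ∈ Asp := by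
  have : Kp 0 1 * Kp 0 1 = PowerSeries.C (1/2) * Kp 0 0 + Kp 0 0 * Kp 0 0 := by
    apply mul_left_cancel₀ one_sub_ne
    apply mul_left_cancel₀ one_sub_ne
    have h2 : (2 : PowerSeries ℚ) * PowerSeries.C (1/2) = 1 := by
      rw [show (2 : PowerSeries ℚ) = PowerSeries.C 2 from C_two.symm, ← map_mul]; simp
    have e1 := E_eq
    have e2 := O_eq
    set Y : PowerSeries ℚ := (1 - PowerSeries.X ^ 2) ^ 2 with hY
    have a1 : Y * (Y * (Kp 0 1 * Kp 0 1)) = (Y * Kp 0 1) * (Y * Kp 0 1) := by ring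
    have a2 : Y * (Y * (PowerSeries.C (1/2) * Kp 0 0 + Kp 0 0 * Kp 0 0)) = Y * PowerSeries.C (1/2) * (Y * Kp 0 0) +  (Y * Kp 0 0) * (Y * Kp 0 0) := by ring
    rw [a1, a2, e1, e2, hY]
    linear_combination -(1 - PowerSeries.X ^ 2)^2 * PowerSeries.X ^ 2 * h2
  rw [this]
  exact Asp.add_mem (C_mul_mem _ (Kp_mem (by norm_num))) (E_mul (Kp_mem (by norm_num)))

lemma Asp_mul {F G : PowerSeries ℚ} (hF : F ∈ Asp) (hG : G ∈ Asp) : F * G ∈ Asp := by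
  have hO : ∀ {F : PowerSeries ℚ}, F ∈ Asp → F * Kp 0 1 ∈ Asp := by
    intro F hF
    rw [mul_comm]
    exact mul_mem_of _ (fun m π h => G_mul_Kp _ (by rw [mul_comm]; exact E_mul (Kp_mem (by norm_num))) OO_mem m π h) hF
  exact mul_mem_of _ (fun m π h => G_mul_Kp _ (by rw [mul_comm]; exact E_mul hF) (hO hF) m π h) hG

lemma Asp_poly {F : PowerSeries ℚ} (hF : F ∈ Asp) (ε : ℕ) :
    ∃ s : Polynomial ℚ, ∀ k : ℕ, k % 2 = ε → PowerSeries.coeff k F = k * s.eval ((k : ℚ) ^ 2) := by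
  unfold Asp at hF
  induction hF using Submodule.span_induction with
  | mem x hx =>
    obtain ⟨m, π, hπ, rfl⟩ := hx
    by_cases h : ε = π
    · refine ⟨Polynomial.X ^ m, fun k hk => ?_⟩
      simp [Kp, hk, h, pow_succ, pow_mul]; ring
    · exact ⟨0, fun k hk => by simp [Kp, hk, h]⟩
  | zero => exact ⟨0, by simp⟩
  | add x y _ _ hx hy =>
    obtain ⟨s, hs⟩ := hx; obtain ⟨t, ht⟩ := hy
    exact ⟨s + t, fun k hk => by simp [hs k hk, ht k hk, mul_add]⟩
  | smul a x _ hx =>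
    obtain ⟨s, hs⟩ := hx
    exact ⟨Polynomial.C a * s, fun k hk => by simp [hs k hk]; ring⟩

noncomputable def Bp (m π : ℕ) : PowerSeries ℚ :=
  PowerSeries.mk fun p => if p % 2 = π then (br p : ℚ) * ((p : ℚ) ^ 2) ^ m else 0

lemma Bp_eq (m π : ℕ) : Bp m π = Kp m π + PowerSeries.C (if π = 0 ∧ m = 0 then 1 else 0) := by
  ext k
  rw [map_add, coeff_Kp, PowerSeries.coeff_C, Bp, PowerSeries.coeff_mk]
  rcases Nat.eq_zero_or_pos k with rfl | hk
  · by_cases hπ : π = 0 <;> by_cases hm : m = 0 <;> simp [hπ, hm, br, eq_comm]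
  · have : k ≠ 0 := by omega
    simp only [br, this, if_false, add_zero]
    split_ifs <;> ring

lemma B_mul {m π : ℕ} (hπ : π < 2) {F : PowerSeries ℚ} (hF : F ∈ Asp) : Bp m π * F ∈ Asp := by
  rw [Bp_eq, add_mul]
  exact Asp.add_mem (Asp_mul (Kp_mem hπ) hF) (C_mul_mem _ hF)

lemma even_ite (n : ℕ) : (if n % 2 = 0 then (n : ℚ) ^ (2 * 0 + 1) else 0) = if Even n then (n : ℚ) else 0 := by
  simp [Nat.even_iff]

lemma sig1 (m ε : ℕ) : ∃ s : Polynomial ℚ, ∀ k : ℕ, k % 2 = ε →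
    ∑ p ∈ Finset.range (k + 1), (if Even (k - p) then (br p : ℚ) * ((k - p : ℕ) : ℚ) * ((p : ℚ) ^ 2) ^ m else 0)
      = k * s.eval ((k : ℚ) ^ 2) := by
  by_cases hε : ε < 2
  · obtain ⟨s, hs⟩ := Asp_poly (B_mul (m := m) hε (Kp_mem (m := 0) (π := 0) (by norm_num))) ε
    refine ⟨s, fun k hk => ?_⟩
    rw [← hs k hk, PowerSeries.coeff_mul, Finset.Nat.sum_antidiagonal_eq_sum_range_succ_mk]
    refine Finset.sum_congr rfl fun p hp => ?_
    have hp' : p ≤ k := by simpa [Nat.lt_succ_iff] using hp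
    simp only [coeff_Kp, even_ite, Bp, PowerSeries.coeff_mk]
    by_cases he : Even (k - p)
    · have : p % 2 = ε := by rw [Nat.even_iff] at he; omega
      simp [he, this]; ring
    · simp [he]
  · exact ⟨0, fun k hk => by omega⟩

lemma sig2 (m l π κ ε : ℕ) (hπ : π < 2) (hκ : κ < 2) : ∃ s : Polynomial ℚ, ∀ k : ℕ, k % 2 = ε →
    ∑ p ∈ Finset.range (k + 1), ∑ q ∈ Finset.range (k - p + 1),
      (if Even (k - p - q) then (if p % 2 = π ∧ q % 2 = κ then (br p : ℚ) * (br q : ℚ) * ((k - p - q : ℕ) : ℚ) *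
        (((p : ℚ) ^ 2) ^ m * ((q : ℚ) ^ 2) ^ l) else 0) else 0)
      = k * s.eval ((k : ℚ) ^ 2) := by
  obtain ⟨s, hs⟩ := Asp_poly (B_mul (m := m) hπ (B_mul (m := l) hκ (Kp_mem (m := 0) (π := 0) (by norm_num)))) ε
  refine ⟨s, fun k hk => ?_⟩
  rw [← hs k hk, PowerSeries.coeff_mul, Finset.Nat.sum_antidiagonal_eq_sum_range_succ_mk]
  refine Finset.sum_congr rfl fun p hp => ?_
  rw [PowerSeries.coeff_mul, Finset.Nat.sum_antidiagonal_eq_sum_range_succ_mk, Finset.mul_sum]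
  refine Finset.sum_congr rfl fun q hq => ?_
  simp only [coeff_Kp, even_ite, Bp, PowerSeries.coeff_mk]
  by_cases he : Even (k - p - q) <;> by_cases h1 : p % 2 = π <;> by_cases h2 : q % 2 = κ <;> simp [he, h1, h2] <;> ring

/-- odd extension of a difference -/
def sgnS (f : ℕ → ℚ) (x y : ℕ) : ℚ := if y ≤ x then f (x - y) else - f (y - x)

lemma two_var (s : Polynomial ℚ) {α : Type} (i j : α) : ∃ R : MvPolynomial α ℚ, ∀ v : α → ℚ,
    (1/2 : ℚ) * ((v i + v j) * s.eval ((v i + v j) ^ 2) + (v i - v j) * s.eval ((v i - v j) ^ 2)) =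
      v i * MvPolynomial.eval (fun a => v a ^ 2) R := by
  induction s using Polynomial.induction_on' with
  | add p q hp hq =>
    obtain ⟨R1, h1⟩ := hp; obtain ⟨R2, h2⟩ := hq
    refine ⟨R1 + R2, fun v => ?_⟩
    have a := h1 v; have b := h2 v
    simp only [Polynomial.eval_add, map_add]
    linear_combination a + b
  | monomial n a =>
    refine ⟨MvPolynomial.C a * ∑ t ∈ Finset.range (n + 1), MvPolynomial.C ((2 * n + 1).choose (2 * t + 1) : ℚ) *
      MvPolynomial.X i ^ t * MvPolynomial.X j ^ (n - t), fun v => ?_⟩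
    have := odd_binom (v i) (v j) n
    simp only [Polynomial.eval_monomial, map_mul, map_sum, MvPolynomial.eval_C, map_pow, MvPolynomial.eval_X]
    have e : v i * (a * ∑ t ∈ Finset.range (n + 1), ((2 * n + 1).choose (2 * t + 1) : ℚ) * (v i ^ 2) ^ t * (v j ^ 2) ^ (n - t))
      = a * ∑ t ∈ Finset.range (n + 1), ((2 * n + 1).choose (2 * t + 1) : ℚ) * v i ^ (2 * t + 1) * v j ^ (2 * (n - t)) := by
      rw [mul_left_comm, Finset.mul_sum]
      congr 1
      refine Finset.sum_congr rfl fun t _ => ?_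
      ring
    rw [e]
    have e2 : (1/2 : ℚ) * ((v i + v j) * (a * ((v i + v j) ^ 2) ^ n) + (v i - v j) * (a * ((v i - v j) ^ 2) ^ n))
      = (1/2 : ℚ) * a * ((v i + v j) ^ (2 * n + 1) + (v i - v j) ^ (2 * n + 1)) := by
      rw [← pow_mul, ← pow_mul, pow_succ (v i + v j), pow_succ (v i - v j)]; ring
    rw [e2, this]; ring

lemma S_poly {α : Type} [Fintype α] (ε : α → ℕ) (i j : α) (R : MvPolynomial (Option α) ℚ) :
    ∃ R' : MvPolynomial α ℚ, ∀ b : α → ℕ, (∀ a, b a % 2 = ε a) →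
      ∀ f : ℕ → ℚ, (f = fun k => ∑ p ∈ Finset.range (k + 1), (if Even (k - p) then (br p : ℚ) * ((k - p : ℕ) : ℚ) *
          MvPolynomial.eval (fun x : Option α => x.elim ((p : ℚ) ^ 2) (fun a => (b a : ℚ) ^ 2)) R else 0)) →
      (1/2 : ℚ) * (f (b i + b j) + sgnS f (b i) (b j)) =
        (b i : ℚ) * MvPolynomial.eval (fun a => (b a : ℚ) ^ 2) R' := by
  induction R using MvPolynomial.induction_on' with
  | add p q hp hq =>
    obtain ⟨R1, h1⟩ := hp; obtain ⟨R2, h2⟩ := hq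
    refine ⟨R1 + R2, fun b hb f hf => ?_⟩
    have a := h1 b hb _ rfl; have c := h2 b hb _ rfl
    have hs : ∀ f1 f2 f : ℕ → ℚ, (∀ k, f k = f1 k + f2 k) → ∀ x y, sgnS f x y = sgnS f1 x y + sgnS f2 x y := by
      intro f1 f2 f h x y
      unfold sgnS; split_ifs <;> rw [h]; ring
    set f1 := fun k => ∑ p_1 ∈ Finset.range (k + 1), (if Even (k - p_1) then (br p_1 : ℚ) * ((k - p_1 : ℕ) : ℚ) *
          MvPolynomial.eval (fun x : Option α => x.elim ((p_1 : ℚ) ^ 2) (fun a => (b a : ℚ) ^ 2)) p else 0)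
    set f2 := fun k => ∑ p_1 ∈ Finset.range (k + 1), (if Even (k - p_1) then (br p_1 : ℚ) * ((k - p_1 : ℕ) : ℚ) *
          MvPolynomial.eval (fun x : Option α => x.elim ((p_1 : ℚ) ^ 2) (fun a => (b a : ℚ) ^ 2)) q else 0)
    have hf12 : ∀ k, f k = f1 k + f2 k := by
      intro k
      simp only [hf, f1, f2, ← Finset.sum_add_distrib]
      refine Finset.sum_congr rfl fun p _ => ?_
      split_ifs
      · rw [map_add]; ring
      · ring
    rw [hf12, hs f1 f2 f hf12, map_add]
    linear_combination a + c
  | monomial u a =>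
    obtain ⟨s, hs⟩ := sig1 (u none) ((ε i + ε j) % 2)
    obtain ⟨T, hT⟩ := two_var s i j
    refine ⟨MvPolynomial.C a * (∏ x : α, MvPolynomial.X x ^ (u (some x))) * T, fun b hb f hf => ?_⟩
    set c : ℚ := a * ∏ x : α, ((b x : ℚ) ^ 2) ^ u (some x) with hc
    have hfk : ∀ k : ℕ, k % 2 = (ε i + ε j) % 2 → f k = c * (k * s.eval ((k : ℚ) ^ 2)) := by
      intro k hk
      rw [← hs k hk, hf, Finset.mul_sum]
      refine Finset.sum_congr rfl fun p _ => ?_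
      rw [MvPolynomial.eval_monomial, Finsupp.prod_fintype _ _ (by simp), Fintype.prod_option]
      simp only [Option.elim_none, Option.elim_some]
      split_ifs
      · rw [hc]; ring
      · ring
    have hsg : sgnS f (b i) (b j) = c * (((b i : ℚ) - b j) * s.eval (((b i : ℚ) - b j) ^ 2)) := by
      have h1 := hb i; have h2 := hb j
      unfold sgnS
      split_ifs with hle
      · rw [hfk _ (by omega), Nat.cast_sub hle]
      · rw [hfk _ (by omega), Nat.cast_sub (by omega), show ((b j : ℚ) - b i) ^ 2 = ((b i : ℚ) - b j) ^ 2 by ring]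
        ring
    have h1 := hb i; have h2 := hb j
    rw [hsg, hfk _ (by omega)]
    have := hT (fun a => (b a : ℚ))
    push_cast
    simp only [map_mul, MvPolynomial.eval_C, map_prod, map_pow, MvPolynomial.eval_X]
    beta_reduce at this
    rw [hc]
    linear_combination (a * ∏ x : α, ((b x : ℚ) ^ 2) ^ u (some x)) * this

lemma T_poly1 {α : Type} [Fintype α] (ε : α → ℕ) (i : α) (π κ : ℕ) (hπ : π < 2) (hκ : κ < 2)
    (R : MvPolynomial (Option (Option α)) ℚ) :
    ∃ R' : MvPolynomial α ℚ, ∀ b : α → ℕ, (∀ a, b a % 2 = ε a) →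
      ∑ p ∈ Finset.range (b i + 1), ∑ q ∈ Finset.range (b i - p + 1),
        (if Even (b i - p - q) then (if p % 2 = π ∧ q % 2 = κ then (br p : ℚ) * (br q : ℚ) * ((b i - p - q : ℕ) : ℚ) *
          MvPolynomial.eval (fun x : Option (Option α) => x.elim ((p : ℚ) ^ 2) (fun y => y.elim ((q : ℚ) ^ 2) (fun a => (b a : ℚ) ^ 2))) R else 0) else 0)
       = (b i : ℚ) * MvPolynomial.eval (fun a => (b a : ℚ) ^ 2) R' := by
  induction R using MvPolynomial.induction_on' with
  | add p q hp hq =>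
    obtain ⟨R1, h1⟩ := hp; obtain ⟨R2, h2⟩ := hq
    refine ⟨R1 + R2, fun b hb => ?_⟩
    rw [map_add, mul_add, ← h1 b hb, ← h2 b hb]
    simp only [← Finset.sum_add_distrib]
    refine Finset.sum_congr rfl fun p _ => Finset.sum_congr rfl fun q _ => ?_
    split_ifs
    · rw [map_add]; ring
    · ring
    · ring
  | monomial u a =>
    obtain ⟨s, hs⟩ := sig2 (u none) (u (some none)) π κ (ε i) hπ hκ
    refine ⟨MvPolynomial.C a * (∏ x : α, MvPolynomial.X x ^ (u (some (some x)))) * Polynomial.aeval (MvPolynomial.X i) s, fun b hb => ?_⟩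
    have := hs (b i) (hb i)
    have e : MvPolynomial.eval (fun a => (b a : ℚ) ^ 2) (Polynomial.aeval (MvPolynomial.X i) s) = s.eval ((b i : ℚ) ^ 2) := by
      have := Polynomial.hom_eval₂ s (algebraMap ℚ (MvPolynomial α ℚ)) (MvPolynomial.eval (fun a => (b a : ℚ) ^ 2)) (MvPolynomial.X i)
      rw [Polynomial.aeval_def, this, MvPolynomial.eval_X, Polynomial.eval]
      congr 1
      exact Subsingleton.elim _ _
    rw [map_mul, e, map_mul, MvPolynomial.eval_C, map_prod, mul_left_comm, ← this, Finset.mul_sum]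
    refine Finset.sum_congr rfl fun p _ => ?_
    rw [Finset.mul_sum]
    refine Finset.sum_congr rfl fun q _ => ?_
    rw [MvPolynomial.eval_monomial, Finsupp.prod_fintype _ _ (by simp), Fintype.prod_option, Fintype.prod_option]
    simp only [Option.elim_none, Option.elim_some, map_pow, MvPolynomial.eval_X]
    split_ifs <;> ring

lemma T_poly {α : Type} [Fintype α] (ε : α → ℕ) (i : α) (X : ℕ → ℕ → (α → ℕ) → ℚ)
    (hX : ∀ π κ : ℕ, ∃ R : MvPolynomial (Option (Option α)) ℚ, ∀ p q : ℕ, ∀ b : α → ℕ, (∀ a, b a % 2 = ε a) →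
      p % 2 = π → q % 2 = κ →
      X p q b = MvPolynomial.eval (fun x : Option (Option α) => x.elim ((p : ℚ) ^ 2) (fun y => y.elim ((q : ℚ) ^ 2) (fun a => (b a : ℚ) ^ 2))) R) :
    ∃ R' : MvPolynomial α ℚ, ∀ b : α → ℕ, (∀ a, b a % 2 = ε a) →
      ∑ p ∈ Finset.range (b i + 1), ∑ q ∈ Finset.range (b i - p + 1),
        (if Even (b i - p - q) then (br p : ℚ) * (br q : ℚ) * ((b i - p - q : ℕ) : ℚ) * X p q b else 0)
       = (b i : ℚ) * MvPolynomial.eval (fun a => (b a : ℚ) ^ 2) R' := by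
  choose R hR using hX
  have h := fun π κ : Fin 2 => T_poly1 ε i π κ π.2 κ.2 (R π κ)
  choose R' hR' using h
  refine ⟨∑ π : Fin 2, ∑ κ : Fin 2, R' π κ, fun b hb => ?_⟩
  simp only [map_sum, Finset.mul_sum]
  simp only [← hR' _ _ b hb]
  simp only [Fin.sum_univ_two, ← Finset.sum_add_distrib]
  refine Finset.sum_congr rfl fun p _ => Finset.sum_congr rfl fun q _ => ?_
  by_cases he : Even (b i - p - q)
  · have h := hR (p % 2) (q % 2) p q b hb rfl rfl
    simp only [he, if_true]
    rw [h]
    rcases Nat.mod_two_eq_zero_or_one p with hp | hp <;> rcases Nat.mod_two_eq_zero_or_one q with hq | hq <;>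
      simp [hp, hq]
  · simp [he]

lemma parity_sep {α : Type} [Fintype α] [DecidableEq α] (ε : α → ℕ) (D : α → MvPolynomial α ℚ)
    (h : ∀ b : α → ℕ, (∀ a, b a % 2 = ε a) →
      ∑ i, (b i : ℚ) * MvPolynomial.eval (fun a => (b a : ℚ) ^ 2) (D i) = 0)
    (b : α → ℕ) (hb : ∀ a, b a % 2 = ε a) (i : α) :
    (b i : ℚ) * MvPolynomial.eval (fun a => (b a : ℚ) ^ 2) (D i) = 0 := by
  set Φ : MvPolynomial α ℚ := ∑ i, MvPolynomial.X i * MvPolynomial.bind₁ (fun a => MvPolynomial.X a ^ 2) (D i) with hΦ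
  have ev : ∀ v : α → ℚ, MvPolynomial.eval v Φ = ∑ i, v i * MvPolynomial.eval (fun a => v a ^ 2) (D i) := by
    intro v
    rw [hΦ, map_sum]
    refine Finset.sum_congr rfl fun i _ => ?_
    rw [map_mul, MvPolynomial.eval_X]
    congr 1
    have := MvPolynomial.eval₂Hom_bind₁ (RingHom.id ℚ) v (fun a => (MvPolynomial.X a ^ 2 : MvPolynomial α ℚ)) (D i)
    refine this.trans ?_
    have e : (fun a => MvPolynomial.eval₂Hom (RingHom.id ℚ) v (MvPolynomial.X a ^ 2 : MvPolynomial α ℚ)) = fun a => v a ^ 2 := by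
      funext a; simp
    rw [e]; rfl
  have h0 : Φ = 0 := by
    apply MvPolynomial.funext_set (fun a => {x : ℚ | ∃ n : ℕ, n % 2 = ε a ∧ x = n})
    · intro a
      have : ε a < 2 := by rw [← hb a]; omega
      refine Set.infinite_of_injective_forall_mem (f := fun n : ℕ => ((2 * n + ε a : ℕ) : ℚ)) ?_ ?_
      · intro x y hxy; simp only [Nat.cast_inj] at hxy; omega
      · intro n; exact ⟨2 * n + ε a, by omega, rfl⟩
    · intro x hx
      have : ∀ a, ∃ n : ℕ, n % 2 = ε a ∧ x a = n := fun a => hx a (Set.mem_univ a)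
      choose n hn1 hn2 using this
      rw [ev, map_zero]
      have := h n hn1
      simpa [hn2] using this
  have e1 := ev (fun a => (b a : ℚ))
  have e2 := ev (Function.update (fun a => (b a : ℚ)) i (-(b i : ℚ)))
  rw [h0, map_zero] at e1 e2
  have sq : (fun a => (Function.update (fun a => (b a : ℚ)) i (-(b i : ℚ)) a) ^ 2) = fun a => (b a : ℚ) ^ 2 := by
    funext a
    by_cases ha : a = i
    · subst ha; simp
    · simp [ha]
  rw [sq] at e2
  rw [← Finset.add_sum_erase _ _ (Finset.mem_univ i)] at e1 e2
  have e3 : ∑ x ∈ Finset.univ.erase i, (Function.update (fun a => (b a : ℚ)) i (-(b i : ℚ)) x) * MvPolynomial.eval (fun a => (b a : ℚ) ^ 2) (D x) = ∑ x ∈ Finset.univ.erase i, (b x : ℚ) * MvPolynomial.eval (fun a => (b a : ℚ) ^ 2) (D x) := by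
    refine Finset.sum_congr rfl fun x hx => ?_
    rw [Function.update_of_ne (Finset.ne_of_mem_erase hx)]
  rw [e3, Function.update_self] at e2
  linarith

def Sc (F : LatticeCountFamily) (g : ℕ) {α : Type} [Fintype α] [DecidableEq α] (i j : α) (b : α → ℕ) (k : ℕ) : ℚ :=
  ∑ p ∈ Finset.range (k + 1),
    (if Even (k - p) then (br p : ℚ) * ((k - p : ℕ) : ℚ) *
      F.N g (Option {a : α // a ≠ i ∧ a ≠ j}) (fun x => Option.elim x p (fun a => b a.1)) else 0)

def Xc (F : LatticeCountFamily) (g : ℕ) {α : Type} [Fintype α] [DecidableEq α] (i : α) (p q : ℕ) (b : α → ℕ) : ℚ :=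
  (if g = 0 then 0 else
      F.N (g - 1) (Option (Option {a : α // a ≠ i}))
        (fun x => Option.elim x p
          (fun y => Option.elim y q (fun a => b a.1))))
    + ∑ g₁ ∈ Finset.range (g + 1),
        ∑ I ∈ (Finset.univ : Finset {a : α // a ≠ i}).powerset,
          (if 3 ≤ 2 * g₁ + (I.card + 1) ∧ 3 ≤ 2 * (g - g₁) + (Iᶜ.card + 1) then
            F.N g₁ (Option {x : {a : α // a ≠ i} // x ∈ I})
              (fun x => Option.elim x p (fun a => b a.1.1)) *
            F.N (g - g₁) (Option {x : {a : α // a ≠ i} // x ∈ Iᶜ})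
              (fun x => Option.elim x q (fun a => b a.1.1))
           else 0)

def Tc (F : LatticeCountFamily) (g : ℕ) {α : Type} [Fintype α] [DecidableEq α] (i : α) (b : α → ℕ) : ℚ :=
  ∑ p ∈ Finset.range (b i + 1), ∑ q ∈ Finset.range (b i - p + 1),
    (if Even (b i - p - q) then (br p : ℚ) * (br q : ℚ) * ((b i - p - q : ℕ) : ℚ) * Xc F g i p q b else 0)

def QP {α : Type} (ε : α → ℕ) (π κ : ℕ) (X : ℕ → ℕ → (α → ℕ) → ℚ) : Prop :=
  ∃ R : MvPolynomial (Option (Option α)) ℚ, ∀ p q : ℕ, ∀ b : α → ℕ, (∀ a, b a % 2 = ε a) →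
      p % 2 = π → q % 2 = κ →
      X p q b = MvPolynomial.eval (fun x : Option (Option α) => x.elim ((p : ℚ) ^ 2) (fun y => y.elim ((q : ℚ) ^ 2) (fun a => (b a : ℚ) ^ 2))) R

lemma QP_zero {α : Type} (ε : α → ℕ) (π κ : ℕ) : QP ε π κ (fun _ _ _ => 0) :=
  ⟨0, fun p q b _ _ _ => by simp⟩

lemma QP_add {α : Type} {ε : α → ℕ} {π κ : ℕ} {X Y} (hX : QP ε π κ X) (hY : QP ε π κ Y) :
    QP ε π κ (fun p q b => X p q b + Y p q b) := by
  obtain ⟨R, hR⟩ := hX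
  obtain ⟨R', hR'⟩ := hY
  exact ⟨R + R', fun p q b h1 h2 h3 => by beta_reduce; rw [hR p q b h1 h2 h3, hR' p q b h1 h2 h3, map_add]⟩

lemma QP_mul {α : Type} {ε : α → ℕ} {π κ : ℕ} {X Y} (hX : QP ε π κ X) (hY : QP ε π κ Y) :
    QP ε π κ (fun p q b => X p q b * Y p q b) := by
  obtain ⟨R, hR⟩ := hX
  obtain ⟨R', hR'⟩ := hY
  exact ⟨R * R', fun p q b h1 h2 h3 => by beta_reduce; rw [hR p q b h1 h2 h3, hR' p q b h1 h2 h3, map_mul]⟩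

lemma QP_sum {α ι : Type} {ε : α → ℕ} {π κ : ℕ} (s : Finset ι) (X : ι → ℕ → ℕ → (α → ℕ) → ℚ)
    (hX : ∀ t, QP ε π κ (X t)) :
    QP ε π κ (fun p q b => ∑ t ∈ s, X t p q b) := by
  choose R hR using hX
  exact ⟨∑ t ∈ s, R t, fun p q b h1 h2 h3 => by
    rw [map_sum]; exact Finset.sum_congr rfl fun t _ => hR t p q b h1 h2 h3⟩

lemma QP_ite {α : Type} {ε : α → ℕ} {π κ : ℕ} (P : Prop) [Decidable P] {X Y} (hX : P → QP ε π κ X) (hY : QP ε π κ Y) :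
    QP ε π κ (fun p q b => if P then X p q b else Y p q b) := by
  by_cases h : P
  · simpa [h] using hX h
  · simpa [h] using hY

lemma QP_atom (F : LatticeCountFamily) (g : ℕ) {α β : Type} [Fintype β] [DecidableEq β]
    (hc : 3 ≤ 2 * g + Fintype.card β) (ε : α → ℕ) (π κ : ℕ) (φ : β → Option (Option α)) :
    QP ε π κ (fun p q b => F.N g β (fun x => (φ x).elim p (fun y => y.elim q b))) := by
  obtain ⟨P, hP⟩ := F.quasipoly g β hc (fun x => (φ x).elim π (fun y => y.elim κ ε))
  refine ⟨MvPolynomial.rename φ P, fun p q b h1 h2 h3 => ?_⟩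
  beta_reduce
  rw [hP, MvPolynomial.eval_rename]
  · congr 2
    funext x
    simp only [Function.comp]
    rcases φ x with _ | _ | a <;> simp
  · intro x
    rcases φ x with _ | _ | a <;> simp [h1, h2, h3]

lemma card_ne {α : Type} [Fintype α] [DecidableEq α] (i : α) : Fintype.card {a : α // a ≠ i} + 1 = Fintype.card α := by
  have : 0 < Fintype.card α := Fintype.card_pos_iff.mpr ⟨i⟩
  rw [Fintype.card_subtype_compl, Fintype.card_subtype_eq]; omega

lemma card_ne2 {α : Type} [Fintype α] [DecidableEq α] {i j : α} (h : j ≠ i) :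
    Fintype.card {a : α // a ≠ i ∧ a ≠ j} + 2 = Fintype.card α := by
  rw [Fintype.card_subtype]
  have e : (Finset.univ.filter fun a => a ≠ i ∧ a ≠ j) = (Finset.univ.erase i).erase j := by
    ext a; simp [and_comm]
  have h1 := Finset.card_erase_add_one (Finset.mem_univ i)
  have h2 := Finset.card_erase_add_one (Finset.mem_erase.mpr ⟨h, Finset.mem_univ j⟩)
  rw [e]
  simp only [Finset.card_univ] at h1 h2
  omega

lemma Xc_QP (F : LatticeCountFamily) (g : ℕ) {α : Type} [Fintype α] [DecidableEq α] (hc : 4 ≤ 2 * g + Fintype.card α)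
    (i : α) (ε : α → ℕ) (π κ : ℕ) : QP ε π κ (Xc F g i) := by
  unfold Xc
  refine QP_add ?_ ?_
  · by_cases hg : g = 0
    · simpa [hg] using QP_zero ε π κ
    simp only [hg, if_false]
    have := QP_atom F (g - 1) (β := Option (Option {a : α // a ≠ i})) (by
      have := card_ne i
      simp only [Fintype.card_option]; omega) ε π κ (Option.map (Option.map Subtype.val))
    convert this using 5 with p q b
    funext x
    rcases x with _ | _ | a <;> rfl
  · refine QP_sum _ _ fun g₁ => QP_sum _ _ fun I => QP_ite _ (fun h => ?_) (QP_zero ε π κ)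
    refine QP_mul ?_ ?_
    · have := QP_atom F g₁ (β := Option {x : {a : α // a ≠ i} // x ∈ I}) (by
        simp only [Fintype.card_option, Fintype.card_coe]; omega) ε π κ (Option.map (fun x => some x.1.1))
      convert this using 5 with p q b
      funext x
      rcases x with _ | a <;> rfl
    · have := QP_atom F (g - g₁) (β := Option {x : {a : α // a ≠ i} // x ∈ Iᶜ}) (by
        simp only [Fintype.card_option, Fintype.card_coe]; omega) ε π κ (fun x => some (Option.map (fun x => x.1.1) x))
      convert this using 5 with p q b
      funext x
      rcases x with _ | a <;> rfl

lemma Sc_poly (F : LatticeCountFamily) (g : ℕ) {α : Type} [Fintype α] [DecidableEq α] (hc : 4 ≤ 2 * g + Fintype.card α)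
    {i j : α} (hij : j ≠ i) (ε : α → ℕ) :
    ∃ R' : MvPolynomial α ℚ, ∀ b : α → ℕ, (∀ a, b a % 2 = ε a) →
      (1/2 : ℚ) * (Sc F g i j b (b i + b j) + sgnS (Sc F g i j b) (b i) (b j)) =
        (b i : ℚ) * MvPolynomial.eval (fun a => (b a : ℚ) ^ 2) R' := by
  obtain ⟨P, hP⟩ := F.quasipoly g (Option {a : α // a ≠ i ∧ a ≠ j}) (by
    have := card_ne2 hij
    simp only [Fintype.card_option]; omega) (fun x => x.elim ((ε i + ε j) % 2) (fun a => ε a.1))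
  obtain ⟨R', hR'⟩ := S_poly ε i j (MvPolynomial.rename (Option.map Subtype.val) P)
  refine ⟨R', fun b hb => ?_⟩
  rw [← hR' b hb _ rfl]
  have key : ∀ k, k % 2 = (ε i + ε j) % 2 → Sc F g i j b k = ∑ p ∈ Finset.range (k + 1), (if Even (k - p) then (br p : ℚ) * ((k - p : ℕ) : ℚ) *
          MvPolynomial.eval (fun x : Option α => x.elim ((p : ℚ) ^ 2) (fun a => (b a : ℚ) ^ 2)) (MvPolynomial.rename (Option.map Subtype.val) P) else 0) := by
    intro k hk
    unfold Sc
    refine Finset.sum_congr rfl fun p hp => ?_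
    have hp' : p ≤ k := by simpa [Nat.lt_succ_iff] using hp
    split_ifs with he
    · rw [hP, MvPolynomial.eval_rename]
      · congr 3
        funext x
        rcases x with _ | a <;> simp
      · rw [Nat.even_iff] at he
        intro x
        rcases x with _ | a
        · simp; omega
        · simp [hb]
    · rfl
  have h1 := hb i; have h2 := hb j
  have e2 : sgnS (Sc F g i j b) (b i) (b j) = sgnS (fun k => ∑ p ∈ Finset.range (k + 1), (if Even (k - p) then (br p : ℚ) * ((k - p : ℕ) : ℚ) *
          MvPolynomial.eval (fun x : Option α => x.elim ((p : ℚ) ^ 2) (fun a => (b a : ℚ) ^ 2)) (MvPolynomial.rename (Option.map Subtype.val) P) else 0)) (b i) (b j) := by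
    unfold sgnS
    split_ifs with hle
    · exact key _ (by omega)
    · exact congrArg _ (key _ (by omega))
  rw [e2, key _ (by omega)]

lemma Sc_symm (F : LatticeCountFamily) (g : ℕ) {α : Type} [Fintype α] [DecidableEq α] (i j : α) (b : α → ℕ) (k : ℕ) :
    Sc F g i j b k = Sc F g j i b k := by
  unfold Sc
  refine Finset.sum_congr rfl fun p hp => ?_
  congr 2
  rw [← F.symm g (Option {a : α // a ≠ i ∧ a ≠ j}) (Option {a : α // a ≠ j ∧ a ≠ i})
    (Equiv.optionCongr (Equiv.subtypeEquivRight fun a => and_comm))]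
  congr 1
  funext x
  rcases x with _ | a <;> rfl

lemma Sc_zero (F : LatticeCountFamily) (g : ℕ) {α : Type} [Fintype α] [DecidableEq α] (i j : α) (b : α → ℕ) :
    Sc F g i j b 0 = 0 := by
  simp [Sc]

lemma sgnS_anti (F : LatticeCountFamily) (g : ℕ) {α : Type} [Fintype α] [DecidableEq α] (i j : α) (b : α → ℕ) (x y : ℕ) :
    sgnS (Sc F g i j b) x y = - sgnS (Sc F g j i b) y x := by
  unfold sgnS
  rcases lt_trichotomy x y with h | h | h
  · simp [h.not_ge, h.le, Sc_symm F g i j]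
  · subst h; simp [Sc_zero]
  · simp [h.not_ge, h.le, Sc_symm F g i j]

theorem asym (F : LatticeCountFamily) (g : ℕ) {α : Type} [Fintype α] [DecidableEq α] (hc : 4 ≤ 2 * g + Fintype.card α)
    (i : α) (b : α → ℕ) :
    (b i : ℚ) * F.N g α b =
      ∑ j ∈ Finset.univ.filter (fun j => j ≠ i), (1/2 : ℚ) * (Sc F g i j b (b i + b j) + sgnS (Sc F g i j b) (b i) (b j))
      + (1/2) * Tc F g i b := by
  obtain ⟨P, hP⟩ := F.quasipoly g α (by omega) (fun a => b a % 2)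
  have hS : ∀ i j : α, ∃ R' : MvPolynomial α ℚ, j ≠ i → ∀ b' : α → ℕ, (∀ a, b' a % 2 = b a % 2) →
      (1/2 : ℚ) * (Sc F g i j b' (b' i + b' j) + sgnS (Sc F g i j b') (b' i) (b' j)) =
        (b' i : ℚ) * MvPolynomial.eval (fun a => (b' a : ℚ) ^ 2) R' := by
    intro i j
    by_cases h : j ≠ i
    · obtain ⟨R', h'⟩ := Sc_poly F g hc h (fun a => b a % 2)
      exact ⟨R', fun _ => h'⟩
    · exact ⟨0, fun h' => absurd h' h⟩
  choose R hR using hS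
  have hT := fun i : α => T_poly (fun a => b a % 2) i (Xc F g i) (fun π κ => Xc_QP F g hc i _ π κ)
  choose T hT using hT
  have hT' : ∀ (i : α) (b' : α → ℕ), (∀ a, b' a % 2 = b a % 2) → Tc F g i b' = (b' i : ℚ) * MvPolynomial.eval (fun a => (b' a : ℚ) ^ 2) (T i) := hT
  have rhs : ∀ (i : α) (b' : α → ℕ), (∀ a, b' a % 2 = b a % 2) →
      ∑ j ∈ Finset.univ.filter (fun j => j ≠ i), (1/2 : ℚ) * (Sc F g i j b' (b' i + b' j) + sgnS (Sc F g i j b') (b' i) (b' j))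
      + (1/2) * Tc F g i b' = (b' i : ℚ) * MvPolynomial.eval (fun a => (b' a : ℚ) ^ 2)
        (∑ j ∈ Finset.univ.filter (fun j => j ≠ i), R i j + MvPolynomial.C (1/2) * T i) := by
    intro i b' hb'
    rw [hT' i b' hb', map_add, map_sum, map_mul, MvPolynomial.eval_C, mul_add, Finset.mul_sum]
    congr 1
    · exact Finset.sum_congr rfl fun j hj => hR i j (by simpa using hj) b' hb'
    · ring
  have := parity_sep (fun a => b a % 2) (fun i => P - (∑ j ∈ Finset.univ.filter (fun j => j ≠ i), R i j + MvPolynomial.C (1/2) * T i)) ?_ b (fun a => rfl) i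
  · rw [map_sub, mul_sub, ← hP b (fun a => rfl), ← rhs i b (fun a => rfl)] at this
    linarith
  · intro b' hb'
    simp only [map_sub, mul_sub]
    simp only [← hP b' hb', ← rhs _ b' hb', Finset.sum_sub_distrib]
    rw [← Finset.sum_mul, F.recursion g α hc b']
    have e1 : ∑ i, ∑ j ∈ Finset.univ.filter (fun j => j ≠ i), sgnS (Sc F g i j b') (b' i) (b' j) = 0 := by
      have : ∑ i, ∑ j ∈ Finset.univ.filter (fun j => j ≠ i), sgnS (Sc F g i j b') (b' i) (b' j)
         = ∑ i, ∑ j, (if j ≠ i then sgnS (Sc F g i j b') (b' i) (b' j) else 0) :=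
        Finset.sum_congr rfl fun i _ => Finset.sum_filter _ _
      rw [this]
      set f : α → α → ℚ := fun i j => (if j ≠ i then sgnS (Sc F g i j b') (b' i) (b' j) else 0) with hf
      have h2 : ∑ i, ∑ j, f i j = - ∑ i, ∑ j, f i j := by
        conv_lhs => rw [Finset.sum_comm]
        rw [← Finset.sum_neg_distrib]
        refine Finset.sum_congr rfl fun i _ => ?_
        rw [← Finset.sum_neg_distrib]
        refine Finset.sum_congr rfl fun j _ => ?_
        simp only [hf]
        by_cases h : j = i
        · subst h; simp
        · rw [if_pos h, if_pos (Ne.symm h), sgnS_anti]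
      linarith
    have e2 : ∑ i, (∑ j ∈ Finset.univ.filter (fun j => j ≠ i), (1/2 : ℚ) * (Sc F g i j b' (b' i + b' j) + sgnS (Sc F g i j b') (b' i) (b' j))
      + (1/2) * Tc F g i b') = (1/2) * ∑ i, ∑ j ∈ Finset.univ.filter (fun j => j ≠ i), Sc F g i j b' (b' i + b' j)
       + (1/2) * ∑ i, ∑ j ∈ Finset.univ.filter (fun j => j ≠ i), sgnS (Sc F g i j b') (b' i) (b' j) + (1/2) * ∑ i, Tc F g i b' := by
      simp only [Finset.mul_sum, ← Finset.sum_add_distrib, mul_add]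
    rw [e2, e1]
    simp only [Sc, Tc, Xc]
    ring

lemma hasSum_fiber {ι κ : Type*} {f : ι → ℂ} {a : ℂ} (hf : HasSum f a) (φ : ι → κ) (s : κ → Finset ι)
    (hs : ∀ c i, i ∈ s c ↔ φ i = c) : HasSum (fun c => ∑ i ∈ s c, f i) a := by
  have h1 : HasSum (f ∘ Equiv.sigmaFiberEquiv φ) a := (Equiv.sigmaFiberEquiv φ).hasSum_iff.mpr hf
  refine h1.sigma fun c => ?_
  have h2 := (s c).hasSum f
  let e : {x // φ x = c} ≃ ↑↑(s c) := Equiv.subtypeEquivRight (fun x => (by simpa using (hs c x).symm))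
  exact e.hasSum_iff.mpr h2

lemma hasSum_mulC {ι κ : Type*} {f : ι → ℂ} {g : κ → ℂ} {s t : ℂ} (hf : HasSum f s) (hg : HasSum g t) :
    HasSum (fun x : ι × κ => f x.1 * g x.2) (s * t) :=
  hf.mul hg (summable_mul_of_summable_norm hf.summable.norm hg.summable.norm)

lemma hasSum_E {t : ℂ} (ht : ‖t‖ < 1) :
    HasSum (fun q : ℕ => if Even q then (1/2 : ℂ) * q * t ^ (q + 1) else 0) (t ^ 3 / (1 - t ^ 2) ^ 2) := by
  have h2 : ‖t ^ 2‖ < 1 := by rw [norm_pow]; exact pow_lt_one₀ (norm_nonneg _) ht (by norm_num)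
  have h := (hasSum_coe_mul_geometric_of_norm_lt_one h2).mul_left t
  have inj : Function.Injective (fun n : ℕ => 2 * n) := fun a b h => by simpa using h
  have e : t * (t ^ 2 / (1 - t ^ 2) ^ 2) = t ^ 3 / (1 - t ^ 2) ^ 2 := by ring
  rw [e] at h
  refine (inj.hasSum_iff ?_).mp (h.congr_fun ?_) 
  · intro x hx
    rw [if_neg]
    rintro ⟨y, rfl⟩
    exact hx ⟨y, by ring⟩
  · intro n
    simp only [Function.comp, even_two_mul, if_true]
    push_cast
    ring

lemma hasSum_N1 {s : ℂ} (hs : ‖s‖ < 1) : HasSum (fun n : ℕ => ((n : ℂ) + 1) * s ^ n) (1 / (1 - s) ^ 2) := by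
  have h := (hasSum_coe_mul_geometric_of_norm_lt_one hs).add (hasSum_geometric_of_norm_lt_one hs)
  have hne : 1 - s ≠ 0 := by
    intro h0
    have : s = 1 := by linear_combination -h0
    rw [this] at hs; simp at hs
  have e : s / (1 - s) ^ 2 + (1 - s)⁻¹ = 1 / (1 - s) ^ 2 := by field_simp; ring
  rw [e] at h
  exact h.congr_fun fun n => by ring

lemma step1 {ι : Type*} (u : ℕ × ι → ℂ) {t Wt : ℂ} (ht0 : t ≠ 0) (ht : ‖t‖ < 1)
    (hu : HasSum (fun x => u x * t ^ ((x.1 : ℤ) - 1)) Wt) :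
    HasSum (fun x : ℕ × ι => (1/2 : ℂ) * (∑ p ∈ Finset.range (x.1 + 1), if Even (x.1 - p) then ((x.1 - p : ℕ) : ℂ) * u (p, x.2) else 0) * t ^ x.1)
      (t ^ 3 / (1 - t ^ 2) ^ 2 * Wt) := by
  classical
  have h := hasSum_fiber (hasSum_mulC (hasSum_E ht) hu) (fun y : ℕ × ℕ × ι => (y.2.1 + y.1, y.2.2))
    (fun c => (Finset.range (c.1 + 1)).image (fun p => (c.1 - p, p, c.2))) (by
      rintro ⟨k, r⟩ ⟨q, p, r'⟩
      simp only [Finset.mem_image, Finset.mem_range, Prod.mk.injEq]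
      constructor
      · rintro ⟨p', h1, h2, rfl, rfl⟩; exact ⟨by omega, rfl⟩
      · rintro ⟨rfl, rfl⟩; exact ⟨p, by omega, by omega, rfl, rfl⟩)
  refine h.congr_fun fun x => ?_
  rw [Finset.sum_image (by
    intro a _ b _ hab
    simp only [Prod.mk.injEq] at hab
    exact hab.2.1), Finset.mul_sum, Finset.sum_mul]
  refine Finset.sum_congr rfl fun p hp => ?_
  have hp' : p ≤ x.1 := by simpa [Nat.lt_succ_iff] using hp
  split_ifs
  · have : t ^ x.1 = t ^ (x.1 - p + 1) * t ^ ((p : ℤ) - 1) := by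
      rw [← zpow_natCast, ← zpow_natCast, ← zpow_add₀ ht0]
      congr 1
      push_cast [hp']
      ring
    simp only
    rw [this]; ring
  · simp

lemma exB {ι : Type*} (H : ℕ × ι → ℂ) (hH : ∀ t : ℂ, 0 < ‖t‖ → ‖t‖ < 1 → Summable (fun x => H x * t ^ x.1))
    {ρ : ℝ} (h0 : 0 < ρ) (h1 : ρ < 1) : ∃ B : ι → ℝ, Summable B ∧ 0 ≤ B ∧ ∀ k r, ‖H (k, r)‖ * ρ ^ k ≤ B r := by
  have h := (hH (ρ : ℂ) (by simpa using h0.ne') (by simpa [abs_of_pos h0] using h1)).norm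
  simp only [norm_mul, norm_pow, Complex.norm_real, Real.norm_of_nonneg h0.le] at h
  have h' : Summable (fun x : ι × ℕ => ‖H (x.2, x.1)‖ * ρ ^ x.2) := (Equiv.prodComm ι ℕ).summable_iff.mpr h
  refine ⟨fun r => ∑' k, ‖H (k, r)‖ * ρ ^ k, h'.prod, fun r => tsum_nonneg fun k => by positivity, fun k r => ?_⟩
  exact (h'.prod_factor r).le_tsum k fun j _ => by positivity

lemma summable_kH {ι : Type*} (H : ℕ × ι → ℂ) (hH : ∀ t : ℂ, 0 < ‖t‖ → ‖t‖ < 1 → Summable (fun x => H x * t ^ x.1))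
    {ρ : ℝ} (h0 : 0 < ρ) (h1 : ρ < 1) : Summable (fun x : ℕ × ι => ‖H x‖ * (x.1 * ρ ^ (x.1 - 1))) := by
  obtain ⟨ρ', h2, h3⟩ := exists_between h1
  have h4 : 0 < ρ' := h0.trans h2
  obtain ⟨B, hB, hB0, hB1⟩ := exB H hH h4 h3
  have hs : ‖ρ / ρ'‖ < 1 := by
    rw [Real.norm_of_nonneg (by positivity)]; exact (div_lt_one h4).mpr h2
  have h5 := (hasSum_coe_mul_geometric_of_norm_lt_one hs).summable.mul_left ρ⁻¹
  have h6 := h5.mul_of_nonneg hB (fun k => by positivity) hB0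
  refine Summable.of_nonneg_of_le (fun x => by positivity) (fun x => ?_) h6
  obtain ⟨k, r⟩ := x
  simp only
  have e : ‖H (k, r)‖ * (k * ρ ^ (k - 1)) = ρ⁻¹ * (k * (ρ / ρ') ^ k) * (‖H (k, r)‖ * ρ' ^ k) := by
    rcases Nat.eq_zero_or_pos k with rfl | hk
    · simp
    · obtain ⟨n, rfl⟩ : ∃ n, k = n + 1 := ⟨k - 1, by omega⟩
      rw [div_pow]
      simp only [Nat.add_sub_cancel]
      field_simp
      ring
  rw [e]
  exact mul_le_mul_of_nonneg_left (hB1 k r) (by positivity)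

lemma deriv_h {ι : Type*} (H : ℕ × ι → ℂ) (h : ℂ → ℂ)
    (hH : ∀ t : ℂ, 0 < ‖t‖ → ‖t‖ < 1 → HasSum (fun x => H x * t ^ x.1) (h t)) {y : ℂ} (hy0 : 0 < ‖y‖) (hy : ‖y‖ < 1) :
    ∃ h' : ℂ, HasDerivAt h h' y ∧ HasSum (fun x : ℕ × ι => H x * (x.1 * y ^ (x.1 - 1))) h' := by
  have hS := fun t h1 h2 => (hH t h1 h2).summable
  obtain ⟨ρ, h2, h3⟩ := exists_between hy
  have h4 : 0 < ρ := hy0.trans h2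
  have hk := summable_kH H hS h4 h3
  have hb : ∀ (n : ℕ × ι), ∀ w ∈ Metric.ball (0 : ℂ) ρ, ‖H n * (n.1 * w ^ (n.1 - 1))‖ ≤ ‖H n‖ * (n.1 * ρ ^ (n.1 - 1)) := by
    intro n w hw
    have : ‖w‖ ≤ ρ := by simpa using (mem_ball_zero_iff.mp hw).le
    rw [norm_mul, norm_mul, norm_pow, Complex.norm_natCast]
    gcongr
  have hyb : y ∈ Metric.ball (0 : ℂ) ρ := by simpa using h2
  have hd := hasDerivAt_tsum_of_isPreconnected (g := fun (n : ℕ × ι) w => H n * w ^ n.1) (g' := fun n w => H n * (n.1 * w ^ (n.1 - 1))) hk Metric.isOpen_ball (convex_ball (0 : ℂ) ρ).isPreconnected (fun n w _ => by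
      exact (hasDerivAt_pow n.1 w).const_mul (H n)) hb hyb (hS y hy0 hy) hyb
  refine ⟨_, hd.congr_of_eventuallyEq ?_, (Summable.of_norm_bounded hk (fun n => hb n y hyb)).hasSum⟩
  have : ∀ᶠ w in nhds y, 0 < ‖w‖ ∧ ‖w‖ < 1 :=
    (continuous_norm.continuousAt.eventually_const_lt hy0).and (continuous_norm.continuousAt.eventually_lt_const hy)
  filter_upwards [this] with w hw
  exact (hH w hw.1 hw.2).tsum_eq.symm

def sgnC (f : ℕ → ℂ) (x y : ℕ) : ℂ := if y ≤ x then f (x - y) else - f (y - x)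

lemma sgnC_eq (f : ℕ → ℂ) (h0 : f 0 = 0) (x y : ℕ) :
    sgnC f x y = (if y ≤ x then f (x - y) else 0) - (if x ≤ y then f (y - x) else 0) := by
  unfold sgnC
  rcases lt_trichotomy x y with h | h | h
  · simp [h.not_ge, h.le]
  · subst h; simp [h0]
  · simp [h.not_ge, h.le]

lemma lt_mul_aux {x y : ℂ} (hx : ‖x‖ < 1) (hy : ‖y‖ < 1) : ‖x * y‖ < 1 := by
  rw [norm_mul]
  exact mul_lt_one_of_nonneg_of_lt_one_left (norm_nonneg _) hx hy.le

lemma term2 {ι : Type*} (H : ℕ × ι → ℂ) (H0 : ∀ r, H (0, r) = 0) {x y hx hy h' : ℂ} (hx1 : ‖x‖ < 1) (hy0 : y ≠ 0) (hy1 : ‖y‖ < 1)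
    (sx : HasSum (fun n => H n * x ^ n.1) hx) (sy : HasSum (fun n => H n * y ^ n.1) hy)
    (sd : HasSum (fun n : ℕ × ι => H n * (n.1 * y ^ (n.1 - 1))) h') :
    HasSum (fun n : ℕ × ℕ × ι => sgnC (fun k => H (k, n.2.2)) n.1 n.2.1 * (((n.2.1 : ℂ) + 1) * x ^ n.1 * y ^ n.2.1))
      (hx / (1 - x * y) ^ 2 - (hy / (1 - x * y) ^ 2 + y * h' / (1 - x * y))) := by
  have hxy := lt_mul_aux hx1 hy1
  have A := hasSum_mulC (hasSum_N1 hxy) sx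
  have B := hasSum_mulC (hasSum_N1 hxy) sy
  have C := (hasSum_mulC (hasSum_geometric_of_norm_lt_one hxy) (sd.mul_left y))
  have i1 : Function.Injective (fun n : ℕ × ℕ × ι => (n.1 + n.2.1, n.1, n.2.2)) := by
    rintro ⟨a, b, c⟩ ⟨a', b', c'⟩ h
    simp only [Prod.mk.injEq] at h ⊢
    exact ⟨by omega, by omega, h.2.2⟩
  have i2 : Function.Injective (fun n : ℕ × ℕ × ι => (n.1, n.1 + n.2.1, n.2.2)) := by
    rintro ⟨a, b, c⟩ ⟨a', b', c'⟩ h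
    simp only [Prod.mk.injEq] at h ⊢
    exact ⟨by omega, by omega, h.2.2⟩
  have P : HasSum (fun n : ℕ × ℕ × ι => (if n.2.1 ≤ n.1 then H (n.1 - n.2.1, n.2.2) else 0) * (((n.2.1 : ℂ) + 1) * x ^ n.1 * y ^ n.2.1)) (1 / (1 - x * y) ^ 2 * hx) := by
    refine (i1.hasSum_iff ?_).mp (A.congr_fun ?_)
    · rintro ⟨a, c, r⟩ h
      rw [if_neg, zero_mul]
      intro hle
      exact h ⟨(c, a - c, r), by simp [Nat.add_sub_cancel' hle]⟩
    · rintro ⟨n, k, r⟩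
      simp
      ring
  have Q : HasSum (fun n : ℕ × ℕ × ι => (if n.1 ≤ n.2.1 then H (n.2.1 - n.1, n.2.2) else 0) * (((n.2.1 : ℂ) + 1) * x ^ n.1 * y ^ n.2.1)) (1 / (1 - x * y) ^ 2 * hy + (1 - x * y)⁻¹ * (y * h')) := by
    refine (i2.hasSum_iff ?_).mp ((B.add C).congr_fun ?_)
    · rintro ⟨a, c, r⟩ h
      rw [if_neg, zero_mul]
      intro hle
      exact h ⟨(a, c - a, r), by simp [Nat.add_sub_cancel' hle]⟩
    · rintro ⟨n, k, r⟩
      rcases Nat.eq_zero_or_pos k with rfl | hk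
      · simp [H0]
      · obtain ⟨l, rfl⟩ : ∃ l, k = l + 1 := ⟨k - 1, by omega⟩
        simp
        ring
  have e : hx / (1 - x * y) ^ 2 - (hy / (1 - x * y) ^ 2 + y * h' / (1 - x * y)) =
    1 / (1 - x * y) ^ 2 * hx - (1 / (1 - x * y) ^ 2 * hy + (1 - x * y)⁻¹ * (y * h')) := by ring
  rw [e]
  refine (P.sub Q).congr_fun fun n => ?_
  rw [sgnC_eq _ (H0 _)]
  ring

lemma poly_id {x y : ℂ} (hxy : x ≠ y) (k : ℕ) :
    ∑ n ∈ Finset.HasAntidiagonal.antidiagonal k, ((n.2 : ℂ) + 1) * x ^ n.1 * y ^ n.2 =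
      (x ^ (k + 2) - y ^ (k + 2)) / (x - y) ^ 2 - (k + 2) * y ^ (k + 1) / (x - y) := by
  have hne : x - y ≠ 0 := sub_ne_zero.mpr hxy
  induction k with
  | zero => simp; field_simp; ring
  | succ k ih =>
    rw [Finset.Nat.antidiagonal_succ, Finset.sum_cons, Finset.sum_map]
    have : ∑ n ∈ Finset.HasAntidiagonal.antidiagonal k, (((Function.Embedding.prodMap ⟨Nat.succ, Nat.succ_injective⟩ (Function.Embedding.refl ℕ) n).2 : ℂ) + 1) * x ^ (Function.Embedding.prodMap ⟨Nat.succ, Nat.succ_injective⟩ (Function.Embedding.refl ℕ) n).1 * y ^ (Function.Embedding.prodMap ⟨Nat.succ, Nat.succ_injective⟩ (Function.Embedding.refl ℕ) n).2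
        = x * ∑ n ∈ Finset.HasAntidiagonal.antidiagonal k, ((n.2 : ℂ) + 1) * x ^ n.1 * y ^ n.2 := by
      rw [Finset.mul_sum]
      refine Finset.sum_congr rfl fun n _ => ?_
      simp [pow_succ]
      ring
    rw [this, ih]
    push_cast
    field_simp
    ring

lemma term1 {ι : Type*} (H : ℕ × ι → ℂ) (H0 : ∀ r, H (0, r) = 0) {x y hx hy h' : ℂ} (hxy : x ≠ y)
    (hS : ∀ t : ℂ, 0 < ‖t‖ → ‖t‖ < 1 → Summable (fun x => H x * t ^ x.1))
    (hx0 : 0 < ‖x‖) (hx1 : ‖x‖ < 1) (hy1 : ‖y‖ < 1)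
    (sx : HasSum (fun n => H n * x ^ n.1) hx) (sy : HasSum (fun n => H n * y ^ n.1) hy)
    (sd : HasSum (fun n : ℕ × ι => H n * (n.1 * y ^ (n.1 - 1))) h') :
    HasSum (fun n : ℕ × ℕ × ι => H (n.1 + n.2.1 + 2, n.2.2) * (((n.2.1 : ℂ) + 1) * x ^ n.1 * y ^ n.2.1))
      ((hx - hy) / (x - y) ^ 2 - h' / (x - y)) := by
  classical
  have hsum : Summable (fun n : ℕ × ℕ × ι => H (n.1 + n.2.1 + 2, n.2.2) * (((n.2.1 : ℂ) + 1) * x ^ n.1 * y ^ n.2.1)) := by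
    obtain ⟨ρ, hρ1, hρ2⟩ := exists_between (max_lt hx1 hy1)
    have hρ0 : 0 < ρ := hx0.trans ((le_max_left _ _).trans_lt hρ1)
    obtain ⟨B, hB, hB0, hB1⟩ := exB H hS hρ0 hρ2
    set s := max ‖x‖ ‖y‖ / ρ with hs
    have hs0 : 0 ≤ s := by positivity
    have hs1 : ‖s‖ < 1 := by
      rw [Real.norm_of_nonneg hs0]; exact (div_lt_one hρ0).mpr hρ1
    have g1 := summable_geometric_of_norm_lt_one hs1
    have g2 := (hasSum_coe_mul_geometric_of_norm_lt_one hs1).summable.add g1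
    have g3 := g1.mul_of_nonneg ((g2.mul_of_nonneg (hB.mul_left (ρ ^ 2)⁻¹) (fun k => by positivity) (fun r => mul_nonneg (by positivity) (hB0 r)))) (fun k => by positivity)
      (fun r => mul_nonneg (by positivity) (mul_nonneg (by positivity) (hB0 _)))
    refine Summable.of_norm_bounded g3 ?_
    rintro ⟨a, c, r⟩
    have hxs : ‖x‖ ≤ s * ρ := by rw [hs, div_mul_cancel₀ _ hρ0.ne']; exact le_max_left _ _
    have hys : ‖y‖ ≤ s * ρ := by rw [hs, div_mul_cancel₀ _ hρ0.ne']; exact le_max_right _ _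
    have hc : ‖(c : ℂ) + 1‖ = c + 1 := by
      have := Complex.norm_natCast (c + 1); push_cast at this; exact this
    simp only [norm_mul, norm_pow, hc]
    calc ‖H (a + c + 2, r)‖ * (((c : ℝ) + 1) * ‖x‖ ^ a * ‖y‖ ^ c)
        ≤ ‖H (a + c + 2, r)‖ * (((c : ℝ) + 1) * (s * ρ) ^ a * (s * ρ) ^ c) := by gcongr
      _ = s ^ a * ((c * s ^ c + s ^ c) * ((ρ ^ 2)⁻¹ * (‖H (a + c + 2, r)‖ * ρ ^ (a + c + 2)))) := by
          field_simp; ring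
      _ ≤ _ := by
          have := hB1 (a + c + 2) r
          gcongr
  have e : HasSum (fun n : ℕ × ι => H n * ((x ^ n.1 - y ^ n.1) / (x - y) ^ 2 - n.1 * y ^ (n.1 - 1) / (x - y))) ((hx - hy) / (x - y) ^ 2 - h' / (x - y)) := by
    refine (((sx.sub sy).div_const ((x - y) ^ 2)).sub (sd.div_const (x - y))).congr_fun fun n => ?_
    ring
  have hf := hasSum_fiber hsum.hasSum (fun n => (n.1 + n.2.1, n.2.2)) (fun c => (Finset.HasAntidiagonal.antidiagonal c.1).image (fun n => (n.1, n.2, c.2))) (by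
    rintro ⟨k, r⟩ ⟨a, c, r'⟩
    simp only [Finset.mem_image, Finset.HasAntidiagonal.mem_antidiagonal, Prod.mk.injEq, Prod.exists]
    constructor
    · rintro ⟨a', c', h1, rfl, rfl, rfl⟩; exact ⟨h1, rfl⟩
    · rintro ⟨h1, rfl⟩; exact ⟨a, c, h1, rfl, rfl, rfl⟩)
  have inj : Function.Injective (fun n : ℕ × ι => (n.1 + 2, n.2)) := by
    rintro ⟨a, b⟩ ⟨a', b'⟩ h
    simp only [Prod.mk.injEq] at h ⊢
    exact ⟨by omega, h.2⟩
  have hne : x - y ≠ 0 := sub_ne_zero.mpr hxy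
  have e2 := (inj.hasSum_iff (f := fun n : ℕ × ι => H n * ((x ^ n.1 - y ^ n.1) / (x - y) ^ 2 - n.1 * y ^ (n.1 - 1) / (x - y))) (by
    rintro ⟨k, r⟩ hk
    rcases k with _ | _ | k
    · simp
    · simp; right; field_simp; ring
    · exact absurd ⟨(k, r), rfl⟩ hk)).mpr e
  have e3 := hf.congr_fun (g := (fun n : ℕ × ι => H n * ((x ^ n.1 - y ^ n.1) / (x - y) ^ 2 - n.1 * y ^ (n.1 - 1) / (x - y))) ∘ (fun n : ℕ × ι => (n.1 + 2, n.2))) ?_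
  · rw [← e3.unique e2]; exact hsum.hasSum
  · rintro ⟨k, r⟩
    rw [Finset.sum_image (by
      rintro ⟨a, b⟩ _ ⟨a', b'⟩ _ hab
      simp only [Prod.mk.injEq] at hab ⊢
      exact ⟨hab.1, hab.2.1⟩)]
    have := poly_id hxy k
    simp only [Function.comp]
    rw [Finset.sum_congr rfl (g := fun n => H (k + 2, r) * (((n.2 : ℂ) + 1) * x ^ n.1 * y ^ n.2)) (by
      intro n hn
      rw [Finset.HasAntidiagonal.mem_antidiagonal.mp hn])]
    rw [← Finset.mul_sum, this]
    push_cast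
    rfl

lemma one_sub_neC {s : ℂ} (hs : ‖s‖ < 1) : 1 - s ≠ 0 := by
  intro h0
  have : s = 1 := by linear_combination -h0
  rw [this] at hs; simp at hs

lemma jpiece {ι : Type*} (H u : ℕ × ι → ℂ) (Wf : ℂ → ℂ)
    (hu : ∀ t : ℂ, 0 < ‖t‖ → ‖t‖ < 1 → HasSum (fun n => u n * t ^ ((n.1 : ℤ) - 1)) (Wf t))
    (hH : ∀ n, H n = (1/2 : ℂ) * (∑ p ∈ Finset.range (n.1 + 1), if Even (n.1 - p) then ((n.1 - p : ℕ) : ℂ) * u (p, n.2) else 0))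
    {x y : ℂ} (hx0 : 0 < ‖x‖) (hx1 : ‖x‖ < 1) (hy0 : 0 < ‖y‖) (hy1 : ‖y‖ < 1) (hxy : x ≠ y) :
    HasSum (fun n : ℕ × ℕ × ι => (H (n.1 + n.2.1, n.2.2) + sgnC (fun k => H (k, n.2.2)) n.1 n.2.1) *
        (x ^ ((n.1 : ℤ) - 1) * ((br n.2.1 : ℂ) * y ^ ((n.2.1 : ℤ) - 1))))
      ((2 / (x * y) + 1 / (x - y) ^ 2 + 1 / (1 - x * y) ^ 2) * (x ^ 3 / (1 - x ^ 2) ^ 2) * Wf x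
        - deriv (fun w => (1 / (x - w) + w / (1 - x * w)) * (w ^ 3 / (1 - w ^ 2) ^ 2) * Wf w) y) := by
  have xne : x ≠ 0 := norm_pos_iff.mp hx0
  have yne : y ≠ 0 := norm_pos_iff.mp hy0
  have H0 : ∀ r, H (0, r) = 0 := by intro r; rw [hH]; simp
  set h : ℂ → ℂ := fun t => t ^ 3 / (1 - t ^ 2) ^ 2 * Wf t with hh
  have hS : ∀ t : ℂ, 0 < ‖t‖ → ‖t‖ < 1 → HasSum (fun n => H n * t ^ n.1) (h t) := by
    intro t h0 h1
    refine (step1 u (norm_pos_iff.mp h0) h1 (hu t h0 h1)).congr_fun fun n => ?_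
    rw [hH]
  obtain ⟨h', hd, sd⟩ := deriv_h H h hS hy0 hy1
  have t1 := term1 H H0 hxy (fun t a b => (hS t a b).summable) hx0 hx1 hy1 (hS x hx0 hx1) (hS y hy0 hy1) sd
  have t2 := term2 H H0 hx1 yne hy1 (hS x hx0 hx1) (hS y hy0 hy1) sd
  have t3 := (hS x hx0 hx1).mul_left (2 / (x * y))
  have i1 : Function.Injective (fun n : ℕ × ℕ × ι => (n.1 + 1, n.2.1 + 1, n.2.2)) := by
    rintro ⟨a, b, c⟩ ⟨a', b', c'⟩ h
    simp only [Prod.mk.injEq] at h ⊢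
    exact ⟨by omega, by omega, h.2.2⟩
  have i2 : Function.Injective (fun n : ℕ × ι => (n.1, 0, n.2) : ℕ × ι → ℕ × ℕ × ι) := by
    rintro ⟨a, b⟩ ⟨a', b'⟩ h
    simp only [Prod.mk.injEq] at h ⊢
    exact ⟨by omega, h.2.2⟩
  have P : HasSum (fun n : ℕ × ℕ × ι => if n.2.1 = 0 then (H (n.1 + n.2.1, n.2.2) + sgnC (fun k => H (k, n.2.2)) n.1 n.2.1) *
        (x ^ ((n.1 : ℤ) - 1) * ((br n.2.1 : ℂ) * y ^ ((n.2.1 : ℤ) - 1))) else 0) (2 / (x * y) * h x) := by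
    refine (i2.hasSum_iff ?_).mp (t3.congr_fun ?_)
    · rintro ⟨a, c, r⟩ hn
      rw [if_neg]
      rintro hc
      simp only at hc
      subst hc
      exact hn ⟨(a, r), rfl⟩
    · rintro ⟨a, r⟩
      simp only [Function.comp, sgnC, br, zpow_sub₀ xne]
      simp
      field_simp
      ring
  have Q : HasSum (fun n : ℕ × ℕ × ι => if n.2.1 = 0 then 0 else (H (n.1 + n.2.1, n.2.2) + sgnC (fun k => H (k, n.2.2)) n.1 n.2.1) *
        (x ^ ((n.1 : ℤ) - 1) * ((br n.2.1 : ℂ) * y ^ ((n.2.1 : ℤ) - 1)))) (((h x - h y) / (x - y) ^ 2 - h' / (x - y)) + (h x / (1 - x * y) ^ 2 - (h y / (1 - x * y) ^ 2 + y * h' / (1 - x * y)))) := by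
    refine (i1.hasSum_iff ?_).mp ((t1.add t2).congr_fun ?_)
    · rintro ⟨a, c, r⟩ hn
      rcases c with _ | c
      · simp
      rcases a with _ | a
      · simp [sgnC]
      · exact absurd ⟨(a, c, r), rfl⟩ hn
    · rintro ⟨a, c, r⟩
      have e : a + 1 + (c + 1) = a + c + 2 := by ring
      simp only [Function.comp, sgnC, br, e]
      simp
      split_ifs <;> ring
  have hxy' := one_sub_neC (lt_mul_aux hx1 hy1)
  have hne : x - y ≠ 0 := sub_ne_zero.mpr hxy
  have hder : deriv (fun w => (1 / (x - w) + w / (1 - x * w)) * (w ^ 3 / (1 - w ^ 2) ^ 2) * Wf w) y =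
      (1 / (x - y) ^ 2 + 1 / (1 - x * y) ^ 2) * h y + (1 / (x - y) + y / (1 - x * y)) * h' := by
    have e : (fun w => (1 / (x - w) + w / (1 - x * w)) * (w ^ 3 / (1 - w ^ 2) ^ 2) * Wf w) = fun w => (1 / (x - w) + w / (1 - x * w)) * h w := by
      funext w; rw [hh]; ring
    rw [e]
    have d1 : HasDerivAt (fun w => x - w) (-1) y := by simpa using (hasDerivAt_id y).const_sub x
    have d2 : HasDerivAt (fun w => 1 - x * w) (-x) y := by simpa using ((hasDerivAt_id y).const_mul x).const_sub 1
    have d3 := ((((hasDerivAt_const y (1 : ℂ)).div d1 hne).add ((hasDerivAt_id y).div d2 hxy')).mul hd).deriv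
    refine d3.trans ?_
    simp only [Pi.add_apply, Pi.div_apply, id]
    ring
  rw [hder]
  have e : (2 / (x * y) + 1 / (x - y) ^ 2 + 1 / (1 - x * y) ^ 2) * (x ^ 3 / (1 - x ^ 2) ^ 2) * Wf x
      - ((1 / (x - y) ^ 2 + 1 / (1 - x * y) ^ 2) * h y + (1 / (x - y) + y / (1 - x * y)) * h') =
      2 / (x * y) * h x + (((h x - h y) / (x - y) ^ 2 - h' / (x - y)) + (h x / (1 - x * y) ^ 2 - (h y / (1 - x * y) ^ 2 + y * h' / (1 - x * y)))) := by
    rw [hh]; ring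
  rw [e]
  refine (P.add Q).congr_fun fun n => ?_
  split_ifs <;> ring

lemma tpiece {B : Type*} (Y : ℕ → ℕ → B → ℂ) {x Xt : ℂ} (xne : x ≠ 0) (hx1 : ‖x‖ < 1)
    (hY : HasSum (fun n : ℕ × ℕ × B => Y n.1 n.2.1 n.2.2 * (x ^ ((n.1 : ℤ) - 1) * x ^ ((n.2.1 : ℤ) - 1))) Xt) :
    HasSum (fun n : ℕ × B => (1/2 : ℂ) * (∑ p ∈ Finset.range (n.1 + 1), ∑ q ∈ Finset.range (n.1 - p + 1),
      if Even (n.1 - p - q) then ((n.1 - p - q : ℕ) : ℂ) * Y p q n.2 else 0) * x ^ ((n.1 : ℤ) - 1))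
      (x ^ 3 / (1 - x ^ 2) ^ 2 * Xt) := by
  classical
  have h := hasSum_fiber (hasSum_mulC (hasSum_E hx1) hY) (fun y : ℕ × ℕ × ℕ × B => (y.2.1 + y.2.2.1 + y.1, y.2.2.2))
    (fun c => ((Finset.range (c.1 + 1)).sigma fun p => Finset.range (c.1 - p + 1)).image (fun p => (c.1 - p.1 - p.2, p.1, p.2, c.2))) (by
      rintro ⟨k, r⟩ ⟨q, p, p', r'⟩
      simp only [Finset.mem_image, Finset.mem_sigma, Finset.mem_range, Prod.mk.injEq, Sigma.exists]
      constructor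
      · rintro ⟨a, b, h1, h2, rfl, rfl, rfl⟩; exact ⟨by omega, rfl⟩
      · rintro ⟨rfl, rfl⟩; exact ⟨p, p', by omega, by omega, rfl, rfl, rfl⟩)
  refine h.congr_fun fun n => ?_
  rw [Finset.sum_image (by
    rintro ⟨a, b⟩ _ ⟨a', b'⟩ _ hab
    simp only [Prod.mk.injEq] at hab
    obtain ⟨_, rfl, rfl, _⟩ := hab
    rfl), Finset.sum_sigma, Finset.mul_sum, Finset.sum_mul]
  refine Finset.sum_congr rfl fun p hp => ?_
  rw [Finset.mul_sum, Finset.sum_mul]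
  refine Finset.sum_congr rfl fun q hq => ?_
  have hp' : p ≤ n.1 := by simpa [Nat.lt_succ_iff] using hp
  have hq' : q ≤ n.1 - p := by simpa [Nat.lt_succ_iff] using hq
  split_ifs
  · have : x ^ ((n.1 : ℤ) - 1) = x ^ (n.1 - p - q + 1) * (x ^ ((p : ℤ) - 1) * x ^ ((q : ℤ) - 1)) := by
      rw [← zpow_natCast, ← zpow_add₀ xne, ← zpow_add₀ xne]
      congr 1
      push_cast [hp', hq']
      ring
    simp only
    rw [this]; ring
  · simp

def Sn (F : LatticeCountFamily) (g : ℕ) {β : Type} [Fintype β] [DecidableEq β] (j : β) (b : β → ℕ) (k : ℕ) : ℚ :=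
  ∑ p ∈ Finset.range (k + 1),
    (if Even (k - p) then (br p : ℚ) * ((k - p : ℕ) : ℚ) *
      F.N g (Option {a : β // a ≠ j}) (fun x => Option.elim x p (fun a => b a.1)) else 0)

def Xn (F : LatticeCountFamily) (g : ℕ) {β : Type} [Fintype β] [DecidableEq β] (p q : ℕ) (b : β → ℕ) : ℚ :=
  (if g = 0 then 0 else
      F.N (g - 1) (Option (Option β)) (fun x => Option.elim x p (fun y => Option.elim y q b)))
    + ∑ g₁ ∈ Finset.range (g + 1),
        ∑ I ∈ (Finset.univ : Finset β).powerset,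
          (if 3 ≤ 2 * g₁ + (I.card + 1) ∧ 3 ≤ 2 * (g - g₁) + (Iᶜ.card + 1) then
            F.N g₁ (Option {x : β // x ∈ I}) (fun x => Option.elim x p (fun a => b a.1)) *
            F.N (g - g₁) (Option {x : β // x ∈ Iᶜ}) (fun x => Option.elim x q (fun a => b a.1))
           else 0)

noncomputable def sigNone (β : Type) : β ≃ {a : Option β // a ≠ none} :=
  Equiv.ofBijective (fun a => ⟨some a, by simp⟩) ⟨fun a b h => by simpa using h, by
    rintro ⟨a, ha⟩
    rcases a with _ | a
    · exact absurd rfl ha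
    · exact ⟨a, rfl⟩⟩

noncomputable def sigNe {β : Type} (j : β) : {a : β // a ≠ j} ≃ {a : Option β // a ≠ none ∧ a ≠ some j} :=
  Equiv.ofBijective (fun a => ⟨some a.1, by simp, by simpa using a.2⟩) ⟨fun a b h => by
      apply Subtype.ext; simpa using h, by
    rintro ⟨a, ha⟩
    rcases a with _ | a
    · exact absurd rfl ha.1
    · exact ⟨⟨a, fun h => ha.2 (by rw [h])⟩, rfl⟩⟩

lemma Sc_eq_Sn (F : LatticeCountFamily) (g : ℕ) {β : Type} [Fintype β] [DecidableEq β] (j : β) (k : ℕ) (b : β → ℕ) :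
    Sc F g none (some j) (fun x : Option β => x.elim k b) = Sn F g j b := by
  funext k'
  unfold Sc Sn
  refine Finset.sum_congr rfl fun p hp => ?_
  congr 2
  rw [← F.symm g _ _ (Equiv.optionCongr (sigNe j))]
  congr 1
  funext x
  rcases x with _ | a <;> rfl

lemma Xc_eq_Xn (F : LatticeCountFamily) (g : ℕ) {β : Type} [Fintype β] [DecidableEq β] (p q k : ℕ) (b : β → ℕ) :
    Xc F g none p q (fun x : Option β => x.elim k b) = Xn F g p q b := by
  unfold Xc Xn
  congr 1
  · congr 1
    rw [← F.symm _ _ _ (Equiv.optionCongr (Equiv.optionCongr (sigNone β)))]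
    congr 1
    funext x
    rcases x with _ | _ | a <;> rfl
  · refine Finset.sum_congr rfl fun g₁ _ => ?_
    rw [Finset.powerset_univ, Finset.powerset_univ]
    symm
    refine Fintype.sum_equiv (Equiv.finsetCongr (sigNone β)) _ _ fun I => ?_
    have h1 : ((Equiv.finsetCongr (sigNone β)) I).card = I.card := by simp
    have h2 : ((Equiv.finsetCongr (sigNone β)) I)ᶜ.card = Iᶜ.card := by
      rw [Finset.card_compl, Finset.card_compl, h1, Fintype.card_congr (sigNone β)]
    rw [h1, h2]
    congr 1
    congr 1
    · rw [← F.symm g₁ _ _ (Equiv.optionCongr ((sigNone β).subtypeEquiv (p := fun x => x ∈ I) (q := fun x => x ∈ (Equiv.finsetCongr (sigNone β)) I) (fun a => by simp)))]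
      congr 1
      funext x
      rcases x with _ | a <;> rfl
    · rw [← F.symm (g - g₁) _ _ (Equiv.optionCongr ((sigNone β).subtypeEquiv (p := fun x => x ∈ Iᶜ) (q := fun x => x ∈ ((Equiv.finsetCongr (sigNone β)) I)ᶜ) (fun a => by simp)))]
      congr 1
      funext x
      rcases x with _ | a <;> rfl

lemma asym_nice (F : LatticeCountFamily) (g : ℕ) {β : Type} [Fintype β] [DecidableEq β] (hc : 4 ≤ 2 * g + (Fintype.card β + 1))
    (k : ℕ) (b : β → ℕ) :
    (k : ℚ) * F.N g (Option β) (fun x => x.elim k b) =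
      ∑ j, (1/2 : ℚ) * (Sn F g j b (k + b j) + sgnS (Sn F g j b) k (b j))
      + (1/2) * ∑ p ∈ Finset.range (k + 1), ∑ q ∈ Finset.range (k - p + 1),
    (if Even (k - p - q) then (br p : ℚ) * (br q : ℚ) * ((k - p - q : ℕ) : ℚ) * Xn F g p q b else 0) := by
  have := asym F g (α := Option β) (by rw [Fintype.card_option]; exact hc) none (fun x => x.elim k b)
  rw [Finset.sum_filter, Fintype.sum_option] at this
  simp only [Sc_eq_Sn, Tc, Xc_eq_Xn] at this
  simp at this ⊢
  exact this

def HWp (F : LatticeCountFamily) (W : (g n : ℕ) → (Fin n → ℂ) → ℂ) : Prop :=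
  ∀ g n : ℕ, 3 ≤ 2 * g + n → ∀ z : Fin n → ℂ,
      (∀ i, 0 < ‖z i‖ ∧ ‖z i‖ < 1) →
      HasSum
        (fun b : Fin n → ℕ => (F.N g (Fin n) b : ℂ) *
          ∏ i, (br (b i) : ℂ) * z i ^ ((b i : ℤ) - 1))
        (W g n z)

lemma genW {F : LatticeCountFamily} {W} (hW : HWp F W) (g : ℕ) {n : ℕ} {β : Type} [Fintype β] [DecidableEq β]
    (e : Fin n ≃ β) (h3 : 3 ≤ 2 * g + n) (z : β → ℂ) (hz : ∀ i, 0 < ‖z i‖ ∧ ‖z i‖ < 1) :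
    HasSum (fun b : β → ℕ => (F.N g β b : ℂ) * ∏ i, (br (b i) : ℂ) * z i ^ ((b i : ℤ) - 1))
      (W g n (fun i => z (e i))) := by
  have h := hW g n h3 (fun i => z (e i)) (fun i => hz (e i))
  have h2 := (Equiv.arrowCongr e.symm (Equiv.refl ℕ)).hasSum_iff.mpr h
  refine h2.congr_fun fun b => ?_
  have e1 : (Equiv.arrowCongr e.symm (Equiv.refl ℕ)) b = b ∘ e := by
    funext x; simp [Equiv.arrowCongr]
  simp only [Function.comp_apply, e1]
  rw [← F.symm g _ _ e b]
  congr 1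
  exact (Equiv.prod_comp e (fun i => (br (b i) : ℂ) * z i ^ ((b i : ℤ) - 1))).symm

lemma genWO {F : LatticeCountFamily} {W} (hW : HWp F W) (g : ℕ) {n : ℕ} {β : Type} [Fintype β] [DecidableEq β]
    (e : Fin n ≃ Option β) (h3 : 3 ≤ 2 * g + n) (t : ℂ) (ht : 0 < ‖t‖ ∧ ‖t‖ < 1) (z : β → ℂ) (hz : ∀ i, 0 < ‖z i‖ ∧ ‖z i‖ < 1) :
    HasSum (fun c : ℕ × (β → ℕ) => (F.N g (Option β) (fun x => x.elim c.1 c.2) : ℂ) * (((br c.1 : ℂ) * t ^ ((c.1 : ℤ) - 1)) *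
      ∏ i, (br (c.2 i) : ℂ) * z i ^ ((c.2 i : ℤ) - 1)))
      (W g n (fun i => (e i).elim t z)) := by
  have h := genW hW g e h3 (fun x => x.elim t z) (by rintro (_ | a); exacts [ht, hz a])
  have h2 := (Equiv.piOptionEquivProd (β := fun _ : Option β => ℕ)).symm.hasSum_iff.mpr h
  refine h2.congr_fun fun c => ?_
  have e1 : (Equiv.piOptionEquivProd (β := fun _ : Option β => ℕ)).symm c = fun x => x.elim c.1 c.2 := by
    funext x; rcases x with _ | a <;> rfl
  simp only [Function.comp_apply, e1, Fintype.prod_option, Option.elim]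

noncomputable def eI {m : ℕ} (I : Finset (Fin m)) : Fin (I.card + 1) ≃ Option {x // x ∈ I} :=
  (finSuccEquiv _).trans (Equiv.optionCongr (I.orderIsoOfFin rfl).toEquiv)

lemma eI_cons {m : ℕ} (I : Finset (Fin m)) (t : ℂ) (zs : Fin m → ℂ) :
    (fun i => (eI I i).elim t (fun a => zs a.1)) = (Fin.cons t (restr zs I) : Fin (I.card + 1) → ℂ) := by
  funext i
  refine Fin.cases ?_ (fun i => ?_) i
  · simp [eI]
  · simp [eI, restr]

lemma succ_cons {m : ℕ} (t : ℂ) (zs : Fin m → ℂ) :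
    (fun i => (finSuccEquiv m i).elim t zs) = (Fin.cons t zs : Fin (m + 1) → ℂ) := by
  funext i
  refine Fin.cases ?_ (fun i => ?_) i <;> simp

/-- j piece -/
lemma jfinal {F : LatticeCountFamily} {W} (hW : HWp F W) (g m : ℕ) (h : 4 ≤ 2 * g + (m + 1)) (x : ℂ) (zs : Fin m → ℂ)
    (hx : 0 < ‖x‖ ∧ ‖x‖ < 1) (hzs : ∀ i, 0 < ‖zs i‖ ∧ ‖zs i‖ < 1) (j : Fin m) (hj : x ≠ zs j) :
    HasSum (fun n : ℕ × (Fin m → ℕ) => (((1/2 : ℚ) * (Sn F g j n.2 (n.1 + n.2 j) + sgnS (Sn F g j n.2) n.1 (n.2 j)) : ℚ) : ℂ) *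
        (x ^ ((n.1 : ℤ) - 1) * ∏ i, (br (n.2 i) : ℂ) * zs i ^ ((n.2 i : ℤ) - 1)))
     ((2 / (x * zs j) + 1 / (x - zs j) ^ 2 + 1 / (1 - x * zs j) ^ 2) * (x ^ 3 / (1 - x ^ 2) ^ 2) *
          W g (((Finset.univ : Finset (Fin m)).erase j).card + 1)
            (Fin.cons x (restr zs ((Finset.univ : Finset (Fin m)).erase j)))
       - deriv (fun w =>
          (1 / (x - w) + w / (1 - x * w)) * (w ^ 3 / (1 - w ^ 2) ^ 2) *
            W g m (Function.update zs j w)) (zs j)) := by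
  set u : ℕ × ({a : Fin m // a ≠ j} → ℕ) → ℂ := fun n => (F.N g (Option {a : Fin m // a ≠ j}) (fun y => y.elim n.1 n.2) : ℂ) * ((br n.1 : ℂ) *
    ∏ i, (br (n.2 i) : ℂ) * zs i ^ ((n.2 i : ℤ) - 1)) with hu
  have upd : ∀ w, (fun i => ((Equiv.optionSubtypeNe j).symm i).elim w (fun a => zs a.1)) = Function.update zs j w := by
    intro w
    funext i
    by_cases hi : i = j
    · subst hi; simp
    · simp [hi, Equiv.optionSubtypeNe_symm_of_ne hi]
  have s1 : ∀ t : ℂ, 0 < ‖t‖ → ‖t‖ < 1 → HasSum (fun n => u n * t ^ ((n.1 : ℤ) - 1)) (W g m (Function.update zs j t)) := by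
    intro t h0 h1
    have := genWO hW g (Equiv.optionSubtypeNe j).symm (by omega) t ⟨h0, h1⟩ (fun a => zs a.1) (fun a => hzs a.1)
    rw [upd] at this
    refine this.congr_fun fun n => ?_
    simp only [hu]; ring
  have hcard : ((Finset.univ : Finset (Fin m)).erase j).card + 1 = m := by
    rw [Finset.card_erase_add_one (Finset.mem_univ j)]; simp
  have s2 : W g (((Finset.univ : Finset (Fin m)).erase j).card + 1)
            (Fin.cons x (restr zs ((Finset.univ : Finset (Fin m)).erase j))) = W g m (Function.update zs j x) := by
    refine HasSum.unique ?_ (s1 x hx.1 hx.2)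
    have := genWO hW g ((eI ((Finset.univ : Finset (Fin m)).erase j)).trans (Equiv.optionCongr (Equiv.subtypeEquivRight (q := fun a => a ≠ j) (fun a => by simp)))) (by omega) x hx (fun a => zs a.1) (fun a => hzs a.1)
    have e : (fun i => (((eI ((Finset.univ : Finset (Fin m)).erase j)).trans (Equiv.optionCongr (Equiv.subtypeEquivRight (q := fun a => a ≠ j) (fun a => by simp)))) i).elim x (fun a => zs a.1)) = (fun i => (eI ((Finset.univ : Finset (Fin m)).erase j) i).elim x (fun a => zs a.1)) := by
      funext i
      rw [Equiv.trans_apply]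
      rcases eI ((Finset.univ : Finset (Fin m)).erase j) i with _ | a <;> rfl
    rw [e] at this
    rw [← eI_cons]
    refine this.congr_fun fun n => ?_
    simp only [hu]; ring
  set H : ℕ × ({a : Fin m // a ≠ j} → ℕ) → ℂ := fun n => (1/2 : ℂ) * (∑ p ∈ Finset.range (n.1 + 1), if Even (n.1 - p) then ((n.1 - p : ℕ) : ℂ) * u (p, n.2) else 0) with hH
  have s3 := jpiece H u (fun w => W g m (Function.update zs j w)) s1 (fun n => rfl) hx.1 hx.2 (hzs j).1 (hzs j).2 hj
  rw [s2]
  have s4 := ((Equiv.refl ℕ).prodCongr (Equiv.funSplitAt j ℕ)).hasSum_iff.mpr s3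
  refine s4.congr_fun ?_
  rintro ⟨k, b⟩
  have hHS : ∀ k, H (k, fun a => b a.1) = (1/2 : ℂ) * (Sn F g j b k : ℂ) * ∏ i : {a : Fin m // a ≠ j}, (br (b i) : ℂ) * zs i ^ ((b i : ℤ) - 1) := by
    intro k
    simp only [hH, Sn]
    rw [Rat.cast_sum, Finset.mul_sum, Finset.mul_sum, Finset.sum_mul]
    refine Finset.sum_congr rfl fun p _ => ?_
    split_ifs
    · simp only [hu]; push_cast; ring
    · simp
  have hsg : sgnC (fun k => H (k, fun a => b a.1)) k (b j) = (1/2 : ℂ) * (sgnS (Sn F g j b) k (b j) : ℂ) * ∏ i : {a : Fin m // a ≠ j}, (br (b i) : ℂ) * zs i ^ ((b i : ℤ) - 1) := by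
    unfold sgnC sgnS
    split_ifs
    · exact hHS _
    · beta_reduce
      rw [hHS]; push_cast; ring
  have hp : ∏ i, (br (b i) : ℂ) * zs i ^ ((b i : ℤ) - 1) = ((br (b j) : ℂ) * zs j ^ ((b j : ℤ) - 1)) * ∏ i : {a : Fin m // a ≠ j}, (br (b i) : ℂ) * zs i ^ ((b i : ℤ) - 1) := by
    rw [← Equiv.prod_comp (Equiv.optionSubtypeNe j), Fintype.prod_option]
    simp
  have e0 : ((Equiv.refl ℕ).prodCongr (Equiv.funSplitAt j ℕ)) (k, b) = (k, b j, fun a => b a.1) := rfl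
  simp only [Function.comp_apply, e0]
  rw [hsg, hHS, hp]
  push_cast
  ring

noncomputable def splitI {m : ℕ} (I : Finset (Fin m)) :
    ℕ × ℕ × (Fin m → ℕ) ≃ (ℕ × ({x // x ∈ I} → ℕ)) × (ℕ × ({x // x ∈ Iᶜ} → ℕ)) :=
  Equiv.ofBijective (fun n => ((n.1, fun a => n.2.2 a.1), (n.2.1, fun a => n.2.2 a.1))) ⟨by
    rintro ⟨p, q, b⟩ ⟨p', q', b'⟩ h
    simp only [Prod.mk.injEq] at h ⊢
    refine ⟨h.1.1, h.2.1, ?_⟩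
    funext a
    by_cases ha : a ∈ I
    · exact congrFun h.1.2 ⟨a, ha⟩
    · exact congrFun h.2.2 ⟨a, by simpa using ha⟩, by
    rintro ⟨⟨p, b⟩, ⟨q, c⟩⟩
    refine ⟨(p, q, fun a => if ha : a ∈ I then b ⟨a, ha⟩ else c ⟨a, by simpa using ha⟩), ?_⟩
    simp only [Prod.mk.injEq, true_and]
    refine ⟨?_, ?_⟩
    · funext a; simp [a.2]
    · funext a
      have := Finset.mem_compl.mp a.2
      simp [this]⟩

lemma xfinal {F : LatticeCountFamily} {W} (hW : HWp F W) (g m : ℕ) (h : 4 ≤ 2 * g + (m + 1)) (x : ℂ) (zs : Fin m → ℂ)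
    (hx : 0 < ‖x‖ ∧ ‖x‖ < 1) (hzs : ∀ i, 0 < ‖zs i‖ ∧ ‖zs i‖ < 1) :
    HasSum (fun n : ℕ × ℕ × (Fin m → ℕ) => ((br n.1 : ℂ) * (br n.2.1 : ℂ) * (Xn F g n.1 n.2.1 n.2.2 : ℂ) * ∏ i, (br (n.2.2 i) : ℂ) * zs i ^ ((n.2.2 i : ℤ) - 1)) *
      (x ^ ((n.1 : ℤ) - 1) * x ^ ((n.2.1 : ℤ) - 1)))
      ((if g = 0 then 0 else
              W (g - 1) (m + 2) (Fin.cons x (Fin.cons x zs)))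
            + ∑ g₁ ∈ Finset.range (g + 1),
                ∑ I ∈ (Finset.univ : Finset (Fin m)).powerset,
                  (if 3 ≤ 2 * g₁ + (I.card + 1) ∧
                      3 ≤ 2 * (g - g₁) + (Iᶜ.card + 1) then
                    W g₁ (I.card + 1) (Fin.cons x (restr zs I)) *
                    W (g - g₁) (Iᶜ.card + 1) (Fin.cons x (restr zs Iᶜ))
                   else 0)) := by
  set wt : ℕ × ℕ × (Fin m → ℕ) → ℂ := fun n => ((br n.1 : ℂ) * (br n.2.1 : ℂ) * ∏ i, (br (n.2.2 i) : ℂ) * zs i ^ ((n.2.2 i : ℤ) - 1)) *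
      (x ^ ((n.1 : ℤ) - 1) * x ^ ((n.2.1 : ℤ) - 1)) with hwt
  have A : HasSum (fun n : ℕ × ℕ × (Fin m → ℕ) => ((if g = 0 then 0 else
      F.N (g - 1) (Option (Option (Fin m))) (fun x => Option.elim x n.1 (fun y => Option.elim y n.2.1 n.2.2)) : ℚ) : ℂ) * wt n) (if g = 0 then 0 else
              W (g - 1) (m + 2) (Fin.cons x (Fin.cons x zs))) := by
    by_cases hg : g = 0
    · simp [hg, hasSum_zero]
    simp only [hg, if_false]
    have h1 := genWO hW (g - 1) ((finSuccEquiv (m + 1)).trans (Equiv.optionCongr (finSuccEquiv m))) (by omega) x hx (fun y => y.elim x zs)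
      (by rintro (_ | a); exacts [hx, hzs a])
    have h2 := ((Equiv.refl ℕ).prodCongr (Equiv.piOptionEquivProd (β := fun _ : Option (Fin m) => ℕ)).symm).hasSum_iff.mpr h1
    have e2 : (fun i => ((finSuccEquiv (m + 1)).trans (Equiv.optionCongr (finSuccEquiv m)) i).elim x (fun y => y.elim x zs)) = (Fin.cons x (Fin.cons x zs : Fin (m + 1) → ℂ) : Fin (m + 2) → ℂ) := by
      rw [← succ_cons x zs, ← succ_cons]
      funext i
      simp only [Equiv.trans_apply]
      rcases finSuccEquiv (m + 1) i with _ | a <;> rfl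
    rw [e2] at h2
    refine h2.congr_fun ?_
    rintro ⟨p, q, b⟩
    have e1 : ((Equiv.refl ℕ).prodCongr (Equiv.piOptionEquivProd (β := fun _ : Option (Fin m) => ℕ)).symm) (p, q, b) = (p, fun y => y.elim q b) := by
      refine Prod.ext rfl ?_
      funext y; rcases y with _ | a <;> rfl
    simp only [Function.comp_apply, e1, Fintype.prod_option, Option.elim, hwt]
    ring
  have C : ∀ (g₁ : ℕ) (I : Finset (Fin m)), HasSum (fun n : ℕ × ℕ × (Fin m → ℕ) => ((if 3 ≤ 2 * g₁ + (I.card + 1) ∧ 3 ≤ 2 * (g - g₁) + (Iᶜ.card + 1) then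
            F.N g₁ (Option {x // x ∈ I}) (fun x => Option.elim x n.1 (fun a => n.2.2 a.1)) *
            F.N (g - g₁) (Option {x // x ∈ Iᶜ}) (fun x => Option.elim x n.2.1 (fun a => n.2.2 a.1))
           else 0 : ℚ) : ℂ) * wt n) (if 3 ≤ 2 * g₁ + (I.card + 1) ∧
                      3 ≤ 2 * (g - g₁) + (Iᶜ.card + 1) then
                    W g₁ (I.card + 1) (Fin.cons x (restr zs I)) *
                    W (g - g₁) (Iᶜ.card + 1) (Fin.cons x (restr zs Iᶜ))
                   else 0) := by
    intro g₁ I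
    split_ifs with hc
    · have h1 := genWO hW g₁ (eI I) hc.1 x hx (fun a => zs a.1) (fun a => hzs a.1)
      have h2 := genWO hW (g - g₁) (eI Iᶜ) hc.2 x hx (fun a => zs a.1) (fun a => hzs a.1)
      rw [eI_cons] at h1 h2
      have h3 := (splitI I).hasSum_iff.mpr (hasSum_mulC h1 h2)
      refine h3.congr_fun ?_
      rintro ⟨p, q, b⟩
      have e1 : splitI I (p, q, b) = ((p, fun a => b a.1), (q, fun a => b a.1)) := rfl
      simp only [Function.comp_apply, e1, hwt]
      rw [← Finset.prod_mul_prod_compl I, ← Finset.prod_coe_sort I, ← Finset.prod_coe_sort Iᶜ]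
      push_cast
      ring
    · simp [hasSum_zero]
  refine (A.add (hasSum_sum (fun g₁ _ => hasSum_sum (fun I _ => C g₁ I)))).congr_fun fun n => ?_
  simp only [← Finset.sum_mul]
  rw [← add_mul, hwt]
  simp only [Xn]
  rw [Rat.cast_add, Rat.cast_sum]
  simp only [Rat.cast_sum]
  ring

theorem asymmetric_aux (Nfam : LatticeCountFamily)
    (W : (g n : ℕ) → (Fin n → ℂ) → ℂ)
    (hW : HWp Nfam W)
    (g m : ℕ) (h : 4 ≤ 2 * g + (m + 1)) (z₁ : ℂ) (zs : Fin m → ℂ)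
    (hx : 0 < ‖z₁‖ ∧ ‖z₁‖ < 1) (hzs : ∀ i, 0 < ‖zs i‖ ∧ ‖zs i‖ < 1) (hdist : ∀ j, z₁ ≠ zs j)
    (A : ℂ)
    (hA : HasSum
      (fun b : Fin m → ℕ => (Nfam.N g (Fin (m + 1)) (Fin.cons 0 b) : ℂ) *
        ∏ j, (br (b j) : ℂ) * zs j ^ ((b j : ℤ) - 1))
      A) :
    W g (m + 1) (Fin.cons z₁ zs) - A / z₁ =
      (∑ j, (2 / (z₁ * zs j) + 1 / (z₁ - zs j) ^ 2 + 1 / (1 - z₁ * zs j) ^ 2) *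
          (z₁ ^ 3 / (1 - z₁ ^ 2) ^ 2) *
          W g (((Finset.univ : Finset (Fin m)).erase j).card + 1)
            (Fin.cons z₁ (restr zs ((Finset.univ : Finset (Fin m)).erase j))))
      - (∑ j, deriv (fun w =>
          (1 / (z₁ - w) + w / (1 - z₁ * w)) * (w ^ 3 / (1 - w ^ 2) ^ 2) *
            W g m (Function.update zs j w)) (zs j))
      + z₁ ^ 3 / (1 - z₁ ^ 2) ^ 2 *
          ((if g = 0 then 0 else
              W (g - 1) (m + 2) (Fin.cons z₁ (Fin.cons z₁ zs)))
            + ∑ g₁ ∈ Finset.range (g + 1),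
                ∑ I ∈ (Finset.univ : Finset (Fin m)).powerset,
                  (if 3 ≤ 2 * g₁ + (I.card + 1) ∧
                      3 ≤ 2 * (g - g₁) + (Iᶜ.card + 1) then
                    W g₁ (I.card + 1) (Fin.cons z₁ (restr zs I)) *
                    W (g - g₁) (Iᶜ.card + 1) (Fin.cons z₁ (restr zs Iᶜ))
                   else 0)) := by
  have xne : z₁ ≠ 0 := norm_pos_iff.mp hx.1
  have hJ := hasSum_sum (s := Finset.univ) (fun j (_ : j ∈ Finset.univ) => jfinal hW g m h z₁ zs hx hzs j (hdist j))
  have hT := tpiece (B := Fin m → ℕ) (fun p q b => (br p : ℂ) * (br q : ℂ) * (Xn Nfam g p q b : ℂ) * ∏ i, (br (b i) : ℂ) * zs i ^ ((b i : ℤ) - 1)) xne hx.2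
    (xfinal hW g m h z₁ zs hx hzs)
  have hR := hJ.add hT
  rw [Finset.sum_sub_distrib] at hR
  refine HasSum.unique ?_ hR
  have hWW := genWO hW g (finSuccEquiv m) (by omega) z₁ hx zs hzs
  rw [succ_cons] at hWW
  have i0 : Function.Injective (fun b : Fin m → ℕ => ((0 : ℕ), b)) := by
    intro a b hab; simpa using hab
  have hA' : HasSum (fun n : ℕ × (Fin m → ℕ) => if n.1 = 0 then (Nfam.N g (Option (Fin m)) (fun x => x.elim n.1 n.2) : ℂ) * (((br n.1 : ℂ) * z₁ ^ ((n.1 : ℤ) - 1)) *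
      ∏ i, (br (n.2 i) : ℂ) * zs i ^ ((n.2 i : ℤ) - 1)) else 0) (A / z₁) := by
    refine (i0.hasSum_iff ?_).mp ((hA.div_const z₁).congr_fun ?_)
    · rintro ⟨k, b⟩ hk
      rw [if_neg]
      intro h0
      simp only at h0
      subst h0
      exact hk ⟨b, rfl⟩
    · intro b
      have e1 : Nfam.N g (Option (Fin m)) (fun x => x.elim 0 b) = Nfam.N g (Fin (m + 1)) (Fin.cons 0 b) := by
        rw [← Nfam.symm g _ _ (finSuccEquiv m)]
        congr 1
        funext i
        refine Fin.cases ?_ (fun i => ?_) i <;> simp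
      simp only [Function.comp_apply, if_true, e1]
      simp [br]
      ring
  refine (hWW.sub hA').congr_fun ?_
  rintro ⟨k, b⟩
  have key := congrArg (fun q : ℚ => (q : ℂ)) (asym_nice Nfam g (β := Fin m) (by simpa using h) k b)
  simp only [Rat.cast_add, Rat.cast_mul, Rat.cast_sum, Rat.cast_natCast] at key
  have e1 : (Nfam.N g (Option (Fin m)) (fun x => x.elim k b) : ℂ) * (((br k : ℂ) * z₁ ^ ((k : ℤ) - 1)) *
      ∏ i, (br (b i) : ℂ) * zs i ^ ((b i : ℤ) - 1)) - (if k = 0 then (Nfam.N g (Option (Fin m)) (fun x => x.elim k b) : ℂ) * (((br k : ℂ) * z₁ ^ ((k : ℤ) - 1)) *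
      ∏ i, (br (b i) : ℂ) * zs i ^ ((b i : ℤ) - 1)) else 0) = ((k : ℂ) * (Nfam.N g (Option (Fin m)) (fun x => x.elim k b) : ℂ)) * (z₁ ^ ((k : ℤ) - 1) *
      ∏ i, (br (b i) : ℂ) * zs i ^ ((b i : ℤ) - 1)) := by
    by_cases hk : k = 0
    · simp [hk]
    · simp only [hk, if_false, br]; ring
  simp only
  rw [e1, key, add_mul, Finset.sum_mul]
  congr 1
  · exact Finset.sum_congr rfl fun j _ => by push_cast; ring
  · rw [Finset.mul_sum, Finset.mul_sum, Finset.sum_mul, Finset.sum_mul]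
    refine Finset.sum_congr rfl fun p _ => ?_
    rw [Finset.mul_sum, Finset.mul_sum, Finset.sum_mul, Finset.sum_mul]
    refine Finset.sum_congr rfl fun q _ => ?_
    split_ifs
    · push_cast; ring
    · simp

/-- The asymmetric form of the recursion for the generating functions
$W_{g,n}$, with the symmetry broken at the variable $z_1$.  Here the total
number of variables is `m + 1` (the variable `z₁` plus `zs : Fin m → ℂ`),
`hW` says that `W` sums the defining series on the punctured unit polydisc,
and `A` is the sum of the series
$\sum_{b} \overline N_{g,n}(0,b_2,\dots,b_n)\prod_j [b_j]z_j^{b_j-1}$,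
i.e. the residue at $z_1 = 0$ of $W_{g,n}(z_1,z_S)$. -/
theorem asymmetric_generating_function_recursion (Nfam : LatticeCountFamily)
    (W : (g n : ℕ) → (Fin n → ℂ) → ℂ)
    (hW : ∀ g n : ℕ, 3 ≤ 2 * g + n → ∀ z : Fin n → ℂ,
      (∀ i, 0 < ‖z i‖ ∧ ‖z i‖ < 1) →
      HasSum
        (fun b : Fin n → ℕ => (Nfam.N g (Fin n) b : ℂ) *
          ∏ i, (br (b i) : ℂ) * z i ^ ((b i : ℤ) - 1))
        (W g n z))
    (g m : ℕ) (h : 4 ≤ 2 * g + (m + 1)) (z₁ : ℂ) (zs : Fin m → ℂ)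
    (hz : ∀ i : Fin (m + 1), 0 < ‖(Fin.cons z₁ zs : Fin (m + 1) → ℂ) i‖ ∧
      ‖(Fin.cons z₁ zs : Fin (m + 1) → ℂ) i‖ < 1)
    (hdist : Function.Injective (Fin.cons z₁ zs : Fin (m + 1) → ℂ))
    (A : ℂ)
    (hA : HasSum
      (fun b : Fin m → ℕ => (Nfam.N g (Fin (m + 1)) (Fin.cons 0 b) : ℂ) *
        ∏ j, (br (b j) : ℂ) * zs j ^ ((b j : ℤ) - 1))
      A) :
    W g (m + 1) (Fin.cons z₁ zs) - A / z₁ =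
      (∑ j, (2 / (z₁ * zs j) + 1 / (z₁ - zs j) ^ 2 + 1 / (1 - z₁ * zs j) ^ 2) *
          (z₁ ^ 3 / (1 - z₁ ^ 2) ^ 2) *
          W g (((Finset.univ : Finset (Fin m)).erase j).card + 1)
            (Fin.cons z₁ (restr zs ((Finset.univ : Finset (Fin m)).erase j))))
      - (∑ j, deriv (fun w =>
          (1 / (z₁ - w) + w / (1 - z₁ * w)) * (w ^ 3 / (1 - w ^ 2) ^ 2) *
            W g m (Function.update zs j w)) (zs j))
      + z₁ ^ 3 / (1 - z₁ ^ 2) ^ 2 *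
          ((if g = 0 then 0 else
              W (g - 1) (m + 2) (Fin.cons z₁ (Fin.cons z₁ zs)))
            + ∑ g₁ ∈ Finset.range (g + 1),
                ∑ I ∈ (Finset.univ : Finset (Fin m)).powerset,
                  (if 3 ≤ 2 * g₁ + (I.card + 1) ∧
                      3 ≤ 2 * (g - g₁) + (Iᶜ.card + 1) then
                    W g₁ (I.card + 1) (Fin.cons z₁ (restr zs I)) *
                    W (g - g₁) (Iᶜ.card + 1) (Fin.cons z₁ (restr zs Iᶜ))
                   else 0)) := by
  exact asymmetric_aux Nfam W hW g m h z₁ zs (by simpa using hz 0)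
    (fun i => by simpa using hz i.succ)
    (fun j hj => by
      have := @hdist 0 j.succ (by simpa using hj)
      exact absurd this (Fin.succ_ne_zero j).symm) A hA
end
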